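/- arXiv:1605.06909 — 5 statements merged into one kernel-verified Lean document; each statement's English description precedes it below -/
import Mathlib

section
/- Let Γ be a countable discrete group, H a separable complex Hilbert space, and π : Γ → GL(H) a group homomorphism into the bounded invertible operators on H. Let G = H ⋊_π Γ be the semidirect product topological group. Then G is a SIN group if and only if π is uniformly bounded, i.e. sup_{s∈Γ} ‖π(s)‖ < ∞. -/
open scoped InnerProductSpace ComplexOrder

/-- The semidirect product `H ⋊_π Γ` of a complex Hilbert space `H` (as additive group) by a
group `Γ` acting via a homomorphism `π : Γ → GL(H)` into the invertible bounded operators: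
the underlying set is `H × Γ` with multiplication `(ξ,s)(η,t) = (ξ + π(s)η, st)`. -/
@[ext]
structure Sdp {Γ H : Type*} [Group Γ] [NormedAddCommGroup H] [InnerProductSpace ℂ H]
    (π : Γ →* (H →L[ℂ] H)ˣ) where
  vec : H
  elt : Γ

namespace Sdp

variable {Γ H : Type*} [Group Γ] [NormedAddCommGroup H] [InnerProductSpace ℂ H]
  {π : Γ →* (H →L[ℂ] H)ˣ}

instance : Mul (Sdp π) :=
  ⟨fun g h => ⟨g.vec + (π g.elt : H →L[ℂ] H) h.vec, g.elt * h.elt⟩⟩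

instance : One (Sdp π) := ⟨⟨0, 1⟩⟩

instance : Inv (Sdp π) :=
  ⟨fun g => ⟨-(((π g.elt)⁻¹ : (H →L[ℂ] H)ˣ) : H →L[ℂ] H) g.vec, g.elt⁻¹⟩⟩

@[simp] lemma mul_vec (g h : Sdp π) :
    (g * h).vec = g.vec + (π g.elt : H →L[ℂ] H) h.vec := rfl
@[simp] lemma mul_elt (g h : Sdp π) : (g * h).elt = g.elt * h.elt := rfl
@[simp] lemma one_vec : (1 : Sdp π).vec = 0 := rfl
@[simp] lemma one_elt : (1 : Sdp π).elt = 1 := rfl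
@[simp] lemma inv_vec (g : Sdp π) :
    (g⁻¹).vec = -(((π g.elt)⁻¹ : (H →L[ℂ] H)ˣ) : H →L[ℂ] H) g.vec := rfl
@[simp] lemma inv_elt (g : Sdp π) : (g⁻¹).elt = g.elt⁻¹ := rfl

/-- The group structure of the semidirect product `H ⋊_π Γ`. -/
instance : Group (Sdp π) where
  mul_assoc a b c := by
    ext
    · simp [map_mul, Units.val_mul, ContinuousLinearMap.mul_apply, map_add, add_assoc]
    · simp [mul_assoc]
  one_mul a := by
    ext
    · simp
    · simp
  mul_one a := by
    ext
    · simp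
    · simp
  inv_mul_cancel a := by
    ext
    · simp [map_inv]
    · simp

/-- The product topology on `H ⋊_π Γ`, where `H` carries the norm topology and `Γ` is
discrete. -/
instance : TopologicalSpace (Sdp π) :=
  TopologicalSpace.induced (fun g : Sdp π => g.vec) inferInstance ⊓
    TopologicalSpace.induced (fun g : Sdp π => g.elt) ⊥

end Sdp

/-- A topological group is SIN if every neighborhood of the identity contains a
conjugation-invariant neighborhood of the identity. -/
def IsSINGroup (G : Type*) [Group G] [TopologicalSpace G] : Prop :=
  ∀ U ∈ nhds (1 : G), ∃ V ∈ nhds (1 : G), V ⊆ U ∧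
    ∀ g : G, (fun x => g⁻¹ * x * g) '' V = V

lemma Sdp.mem_nhds_one_iff {Γ H : Type*} [Group Γ] [NormedAddCommGroup H]
    [InnerProductSpace ℂ H] {π : Γ →* (H →L[ℂ] H)ˣ} (V : Set (Sdp π)) :
    V ∈ nhds (1 : Sdp π) ↔ ∃ ε > 0, ∀ v : H, ‖v‖ < ε → (⟨v, 1⟩ : Sdp π) ∈ V := by
  letI : TopologicalSpace Γ := ⊥
  haveI : DiscreteTopology Γ := ⟨rfl⟩
  have h : nhds (1 : Sdp π) = Filter.comap (fun g : Sdp π => g.vec) (nhds 0) ⊓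
      Filter.comap (fun g : Sdp π => g.elt) (pure 1) := by
    refine (nhds_inf (t₁ := TopologicalSpace.induced (fun g : Sdp π => g.vec) inferInstance)
      (t₂ := TopologicalSpace.induced (fun g : Sdp π => g.elt) ⊥)).trans ?_
    rw [nhds_induced, nhds_induced, ← nhds_discrete Γ]
    rfl
  rw [h, Filter.comap_pure, Filter.mem_inf_principal, Filter.mem_comap]
  constructor
  · rintro ⟨t, ht, hV⟩
    obtain ⟨ε, hε, hb⟩ := Metric.mem_nhds_iff.1 ht
    refine ⟨ε, hε, fun v hv => ?_⟩
    have h1 : v ∈ t := hb (by simpa using hv)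
    have h2 : (⟨v, 1⟩ : Sdp π) ∈ (fun g : Sdp π => g.vec) ⁻¹' t := h1
    exact hV h2 rfl
  · rintro ⟨ε, hε, hV⟩
    refine ⟨Metric.ball 0 ε, Metric.ball_mem_nhds _ hε, ?_⟩
    rintro ⟨v, s⟩ hv hs
    have hs' : s = 1 := hs
    subst hs'
    exact hV v (by simpa using hv)

lemma Sdp.conj_eq {Γ H : Type*} [Group Γ] [NormedAddCommGroup H]
    [InnerProductSpace ℂ H] {π : Γ →* (H →L[ℂ] H)ˣ} (g : Sdp π) (v : H) :
    g⁻¹ * ⟨v, 1⟩ * g = ⟨(π g.elt⁻¹ : H →L[ℂ] H) v, 1⟩ := by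
  ext
  · simp [map_inv]
  · simp

/-- The semidirect product `G = H ⋊_π Γ` is a SIN group if and only if `π` is
uniformly bounded. -/
theorem stmt3 {Γ H : Type*} [Group Γ] [Countable Γ]
    [NormedAddCommGroup H] [InnerProductSpace ℂ H] [CompleteSpace H]
    [TopologicalSpace.SeparableSpace H]
    (π : Γ →* (H →L[ℂ] H)ˣ) :
    IsSINGroup (Sdp π) ↔ ∃ C : ℝ, ∀ s : Γ, ‖(π s : H →L[ℂ] H)‖ ≤ C := by
  constructor
  · intro h
    obtain ⟨V, hV, hVU, hinv⟩ := h {g | ‖g.vec‖ < 1}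
      ((Sdp.mem_nhds_one_iff _).2 ⟨1, one_pos, fun v hv => hv⟩)
    obtain ⟨δ, hδ, hδV⟩ := (Sdp.mem_nhds_one_iff _).1 hV
    refine ⟨2 / δ, fun s => ContinuousLinearMap.opNorm_le_bound _ (by positivity) fun x => ?_⟩
    rcases eq_or_ne x 0 with rfl | hx
    · simp
    have hx' : 0 < ‖x‖ := norm_pos_iff.2 hx
    have key : ∀ v : H, ‖v‖ < δ → ‖(π s : H →L[ℂ] H) v‖ < 1 := by
      intro v hv
      have h1 : (⟨v, 1⟩ : Sdp π) ∈ V := hδV v hv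
      have h2 : (⟨0, s⁻¹⟩ : Sdp π)⁻¹ * ⟨v, 1⟩ * ⟨0, s⁻¹⟩ ∈ V := by
        rw [← hinv ⟨0, s⁻¹⟩]
        exact ⟨_, h1, rfl⟩
      rw [Sdp.conj_eq] at h2
      simpa using hVU h2
    have hr : 0 < δ / (2 * ‖x‖) := by positivity
    have hn : ‖((δ / (2 * ‖x‖) : ℝ) : ℂ)‖ = δ / (2 * ‖x‖) := by
      rw [Complex.norm_real, Real.norm_of_nonneg hr.le]
    have h3 := key (((δ / (2 * ‖x‖) : ℝ) : ℂ) • x) (by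
      rw [norm_smul, hn]
      have : δ / (2 * ‖x‖) * ‖x‖ = δ / 2 := by field_simp
      linarith)
    rw [map_smul, norm_smul, hn] at h3
    have h4 : 2 / δ * ‖x‖ = 1 / (δ / (2 * ‖x‖)) := by field_simp
    rw [h4, le_div_iff₀ hr]
    linarith
  · rintro ⟨C, hC⟩ U hU
    obtain ⟨ε, hε, hεU⟩ := (Sdp.mem_nhds_one_iff _).1 hU
    have hC0 : 0 ≤ C := (norm_nonneg _).trans (hC 1)
    have hsub : ∀ g : Sdp π, ∀ x ∈ {y : Sdp π | ∃ s : Γ, ∃ w : H, ‖w‖ < ε / (C + 1) ∧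
        y = ⟨(π s : H →L[ℂ] H) w, 1⟩}, g⁻¹ * x * g ∈ {y : Sdp π | ∃ s : Γ, ∃ w : H,
        ‖w‖ < ε / (C + 1) ∧ y = ⟨(π s : H →L[ℂ] H) w, 1⟩} := by
      rintro g x ⟨s, w, hw, rfl⟩
      refine ⟨g.elt⁻¹ * s, w, hw, ?_⟩
      rw [Sdp.conj_eq, map_mul]
      rfl
    refine ⟨{y : Sdp π | ∃ s : Γ, ∃ w : H, ‖w‖ < ε / (C + 1) ∧
        y = ⟨(π s : H →L[ℂ] H) w, 1⟩}, ?_, ?_, fun g => ?_⟩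
    · exact (Sdp.mem_nhds_one_iff _).2 ⟨ε / (C + 1), by positivity,
        fun v hv => ⟨1, v, hv, by simp⟩⟩
    · rintro y ⟨s, w, hw, rfl⟩
      apply hεU
      have h1 := (π s : H →L[ℂ] H).le_of_opNorm_le (hC s) w
      rw [lt_div_iff₀ (by positivity)] at hw
      rcases (norm_nonneg w).eq_or_lt with h0 | h0
      · rw [← h0] at h1
        linarith
      · nlinarith
    · apply Set.Subset.antisymm
      · rintro _ ⟨x, hx, rfl⟩
        exact hsub g x hx
      · intro x hx
        refine ⟨g * x * g⁻¹, ?_, by simp [mul_assoc]⟩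
        simpa using hsub g⁻¹ x hx
end

section
/- (Equivariant Maurey–Nikishin factorization.) Let Γ be a countable discrete group, H a separable real Hilbert space, and π : Γ → GL(H) a uniformly bounded group homomorphism into the bounded invertible operators on H. Let (X,m) be a probability space, let β be an action of Γ on (X,m) by measure-preserving measurable bijections, and let T : H → L⁰(X,m) be an ℝ-linear map that is continuous in measure and equivariant: for every s ∈ Γ and ξ ∈ H, T(π(s)ξ)(x) = (Tξ)(β(s)⁻¹x) for m-a.e. x. Then there exists a bounded measurable function φ : X → ℝ with φ(x) > 0 for m-a.e. x, which is Γ-invariant (φ ∘ β(s) = φ m-a.e. for every s ∈ Γ), such that ∫_X φ(x)·(Tξ)(x)² dm(x) ≤ ‖ξ‖² for every ξ ∈ H. -/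
open MeasureTheory Filter

theorem mn_pt (a b : ℝ) (ha : 0 ≤ a) (hb : 0 ≤ b) :
    1 / (1 + (2⁻¹ * a + 2⁻¹ * b)) ≤ (1 / (1 + a) + 1 / (1 + b)) / 2
      - (1 / (1 + a) - 1 / (1 + b)) ^ 2 / 4 := by
  have h1 : 0 < 1 + a := by linarith
  have h2 : 0 < 1 + b := by linarith
  set u := 1 / (1 + a) with hu
  set v := 1 / (1 + b) with hv
  have hu0 : 0 < u := by positivity
  have hv0 : 0 < v := by positivity
  have hu1 : u ≤ 1 := by rw [hu, div_le_one h1]; linarith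
  have hv1 : v ≤ 1 := by rw [hv, div_le_one h2]; linarith
  have ea : a = 1 / u - 1 := by rw [hu]; simp
  have eb : b = 1 / v - 1 := by rw [hv]; simp
  have : 1 / (1 + (2⁻¹ * a + 2⁻¹ * b)) = (u + v) / 2 - (u - v) ^ 2 / (2 * (u + v)) := by
    rw [ea, eb]
    have : 1 + (2⁻¹ * (1 / u - 1) + 2⁻¹ * (1 / v - 1)) = (u + v) / (2 * u * v) := by
      field_simp; ring
    rw [this]
    field_simp
    ring
  rw [this]
  have : (u - v) ^ 2 / 4 ≤ (u - v) ^ 2 / (2 * (u + v)) := by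
    apply div_le_div_of_nonneg_left (sq_nonneg _) (by positivity) (by linarith)
  linarith

section
variable {X : Type*} [MeasurableSpace X] (m : Measure X) [IsProbabilityMeasure m]

theorem mn_int {f : X → ℝ} (C : ℝ) (hf : Measurable f) (h : ∀ x, |f x| ≤ C) : Integrable f m :=
  Integrable.of_bound hf.aestronglyMeasurable C (ae_of_all _ h)

theorem mn_cauchy (g : ℕ → X → ℝ) (hg : ∀ n, Measurable (g n)) (hi : ∀ n, Integrable (g n) m)
    (hs : ∀ n k, Integrable (fun x => (g n x - g k x) ^ 2) m)
    (h : ∀ N n k : ℕ, N ≤ n → N ≤ k → ∫ x, (g n x - g k x) ^ 2 ∂m ≤ (1/4) ^ N) :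
    ∀ᵐ x ∂m, ∃ l : ℝ, Tendsto (fun n => g n x) atTop (nhds l) := by
  refine Lp.ae_tendsto_of_cauchy_eLpNorm (p := 1) (fun n => (hg n).aestronglyMeasurable) le_rfl
    (B := fun N => ENNReal.ofReal (2 * (1/2) ^ N)) ?_ ?_
  · rw [← ENNReal.ofReal_tsum_of_nonneg (fun n => by positivity)
      (summable_geometric_two.mul_left 2)]
    exact ENNReal.ofReal_ne_top
  · intro N n k hn hk
    rw [eLpNorm_one_eq_lintegral_enorm, ← ofReal_integral_norm_eq_lintegral_enorm
      ((hi n).sub (hi k))]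
    rw [ENNReal.ofReal_lt_ofReal_iff (by positivity)]
    have hp : (0:ℝ) < (1/2) ^ N := by positivity
    have h1 : ∫ x, ‖(g n - g k) x‖ ∂m ≤
        ∫ x, ((2:ℝ) ^ N * (g n x - g k x) ^ 2 / 2 + (1/2) ^ N / 2) ∂m := by
      refine integral_mono ((hi n).sub (hi k)).norm
        ((((hs n k).const_mul _).div_const 2).add (integrable_const _)) (fun x => ?_)
      simp only [Pi.sub_apply, Real.norm_eq_abs]
      rw [← sq_abs (g n x - g k x)]
      set y := |g n x - g k x|
      have e : (2:ℝ) ^ N * (1/2) ^ N = 1 := by rw [← mul_pow]; norm_num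
      have e2 : (2:ℝ) ^ N * y ^ 2 / 2 + (1/2) ^ N / 2 - y =
        2 ^ N * (y - (1/2) ^ N) ^ 2 / 2 := by
        linear_combination (y - (1/2) ^ N / 2) * e
      have : (0:ℝ) ≤ 2 ^ N * (y - (1/2) ^ N) ^ 2 / 2 := by positivity
      linarith
    have h2 : ∫ x, ((2:ℝ) ^ N * (g n x - g k x) ^ 2 / 2 + (1/2) ^ N / 2) ∂m =
        (2:ℝ) ^ N * (∫ x, (g n x - g k x) ^ 2 ∂m) / 2 + (1/2) ^ N / 2 := by
      rw [← integral_const_mul, ← integral_div]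
      have := integral_add (((hs n k).const_mul ((2:ℝ) ^ N)).div_const 2)
        (integrable_const (μ := m) ((1/2 : ℝ) ^ N / 2))
      simpa using this
    have h3 : (2:ℝ) ^ N * (∫ x, (g n x - g k x) ^ 2 ∂m) ≤ 2 ^ N * (1/4) ^ N := by
      gcongr; exact h N n k hn hk
    have h4 : (2:ℝ) ^ N * (1/4) ^ N = (1/2) ^ N := by rw [← mul_pow]; norm_num
    linarith

theorem mn_abstract (K : Set (X → ℝ)) (hne : K.Nonempty) (hK : Convex ℝ K)
    (hm : ∀ F ∈ K, Measurable F) (h0 : ∀ F ∈ K, ∀ x, 0 ≤ F x)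
    (ht : ∀ ε > 0, ∃ M : ℝ, 0 ≤ M ∧ ∀ F ∈ K, m.real {x | M ≤ F x} ≤ ε) :
    ∃ G : X → ℝ, Measurable G ∧ (∀ x, 0 ≤ G x ∧ G x ≤ 1) ∧ (∀ᵐ x ∂m, 0 < G x) ∧
      (∀ b : X → X, MeasurePreserving b m m → (∀ F ∈ K, F ∘ b ∈ K) →
        (fun x => G (b x)) =ᵐ[m] G) ∧
      ∀ F ∈ K, ∫⁻ x, ENNReal.ofReal (G x ^ 2 * F x) ∂m ≤ 1 := by
  have hgm : ∀ F ∈ K, Measurable (fun x => 1 / (1 + F x)) := fun F hF =>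
    measurable_const.div (measurable_const.add (hm F hF))
  have hg0 : ∀ F ∈ K, ∀ x, 0 < 1 / (1 + F x) := fun F hF x => by
    have := h0 F hF x
    positivity
  have hg1 : ∀ F ∈ K, ∀ x, 1 / (1 + F x) ≤ 1 := fun F hF x => by
    have := h0 F hF x
    rw [div_le_one (by linarith)]; linarith
  have hgi : ∀ F ∈ K, Integrable (fun x => 1 / (1 + F x)) m := fun F hF =>
    mn_int m 1 (hgm F hF) (fun x => by rw [abs_of_pos (hg0 F hF x)]; exact hg1 F hF x)
  set J : (X → ℝ) → ℝ := fun F => ∫ x, 1 / (1 + F x) ∂m with hJ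
  have hJ0 : ∀ F ∈ K, 0 ≤ J F := fun F hF => integral_nonneg (fun x => (hg0 F hF x).le)
  set I := sInf (J '' K) with hI
  have hbdd : BddBelow (J '' K) := ⟨0, by rintro _ ⟨F, hF, rfl⟩; exact hJ0 F hF⟩
  have hIle : ∀ F ∈ K, I ≤ J F := fun F hF => csInf_le hbdd ⟨F, hF, rfl⟩
  have hsqi : ∀ F ∈ K, ∀ F' ∈ K,
      Integrable (fun x => (1 / (1 + F x) - 1 / (1 + F' x)) ^ 2) m := by
    intro F hF F' hF'
    refine mn_int m 1 (((hgm F hF).sub (hgm F' hF')).pow_const 2) (fun x => ?_)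
    have a1 := hg0 F hF x
    have a2 := hg1 F hF x
    have a3 := hg0 F' hF' x
    have a4 := hg1 F' hF' x
    rw [abs_of_nonneg (sq_nonneg _), sq_le_one_iff_abs_le_one, abs_le]
    constructor <;> linarith
  have hpar : ∀ F ∈ K, ∀ F' ∈ K,
      ∫ x, (1 / (1 + F x) - 1 / (1 + F' x)) ^ 2 ∂m ≤ 2 * (J F + J F') - 4 * I := by
    intro F hF F' hF'
    have hmid : (2⁻¹ : ℝ) • F + (2⁻¹ : ℝ) • F' ∈ K :=
      hK hF hF' (by norm_num) (by norm_num) (by norm_num)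
    have h1 := hIle _ hmid
    have h2 : J ((2⁻¹ : ℝ) • F + (2⁻¹ : ℝ) • F') ≤ ∫ x, ((1 / (1 + F x) + 1 / (1 + F' x)) / 2
      - (1 / (1 + F x) - 1 / (1 + F' x)) ^ 2 / 4) ∂m := by
      apply integral_mono (hgi _ hmid)
        ((((hgi F hF).add (hgi F' hF')).div_const 2).sub ((hsqi F hF F' hF').div_const 4))
      intro x
      exact mn_pt _ _ (h0 F hF x) (h0 F' hF' x)
    have e2 : ∫ x, ((1 / (1 + F x) + 1 / (1 + F' x)) / 2
      - (1 / (1 + F x) - 1 / (1 + F' x)) ^ 2 / 4) ∂m = (∫ x, 1 / (1 + F x) ∂m +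
        ∫ x, 1 / (1 + F' x) ∂m) / 2 - (∫ x, (1 / (1 + F x) - 1 / (1 + F' x)) ^ 2 ∂m) / 4 := by
      rw [← integral_add (hgi F hF) (hgi F' hF'), ← integral_div, ← integral_div]
      exact integral_sub (((hgi F hF).add (hgi F' hF')).div_const 2)
        ((hsqi F hF F' hF').div_const 4)
    rw [e2] at h2
    simp only [hJ] at h1 h2 ⊢
    linarith
  have hseq : ∀ n : ℕ, ∃ F ∈ K, J F < I + (1/4) ^ n / 4 := by
    intro n
    obtain ⟨_, ⟨F, hF, rfl⟩, h⟩ := exists_lt_of_csInf_lt (hne.image J)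
      (show sInf (J '' K) < I + (1/4) ^ n / 4 by rw [← hI]; linarith [show (0:ℝ) < (1/4)^n by positivity])
    exact ⟨F, hF, h⟩
  choose F hFK hFJ using hseq
  have hae : ∀ᵐ x ∂m, ∃ l : ℝ, Tendsto (fun n => 1 / (1 + F n x)) atTop (nhds l) := by
    refine mn_cauchy m (fun n x => 1 / (1 + F n x)) (fun n => hgm _ (hFK n))
      (fun n => hgi _ (hFK n)) (fun n k => hsqi _ (hFK n) _ (hFK k)) (fun N n k hn hk => ?_)
    have h1 := hpar _ (hFK n) _ (hFK k)
    have h2 : ((1:ℝ)/4) ^ n ≤ (1/4) ^ N := pow_le_pow_of_le_one (by norm_num) (by norm_num) hn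
    have h3 : ((1:ℝ)/4) ^ k ≤ (1/4) ^ N := pow_le_pow_of_le_one (by norm_num) (by norm_num) hk
    linarith [hFJ n, hFJ k]
  obtain ⟨f, hfm, hf⟩ := measurable_limit_of_tendsto_metrizable_ae
    (fun n => (hgm _ (hFK n)).aemeasurable) hae
  set G : X → ℝ := fun x => max 0 (min 1 (f x)) with hG
  have hGm : Measurable G := measurable_const.max (measurable_const.min hfm)
  have hG0 : ∀ x, 0 ≤ G x := fun x => le_max_left _ _
  have hG1 : ∀ x, G x ≤ 1 := fun x => max_le zero_le_one (min_le_left _ _)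
  have hlim : ∀ᵐ x ∂m, Tendsto (fun n => 1 / (1 + F n x)) atTop (nhds (G x)) := by
    filter_upwards [hf] with x hx
    have : G x = f x := by
      have a1 : 0 ≤ f x := ge_of_tendsto' hx (fun n => (hg0 _ (hFK n) x).le)
      have a2 : f x ≤ 1 := le_of_tendsto' hx (fun n => hg1 _ (hFK n) x)
      simp [hG, a1, a2]
    rw [this]; exact hx
  have hFJlim : Tendsto (fun n => J (F n)) atTop (nhds I) := by
    refine tendsto_of_tendsto_of_tendsto_of_le_of_le tendsto_const_nhds ?_
      (fun n => hIle _ (hFK n)) (fun n => (hFJ n).le)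
    have := (tendsto_pow_atTop_nhds_zero_of_lt_one (r := (1:ℝ)/4) (by norm_num) (by norm_num))
    simpa using (this.div_const 4).const_add I
  have hGI : ∫ x, G x ∂m = I := by
    refine tendsto_nhds_unique ?_ hFJlim
    refine tendsto_integral_of_dominated_convergence (fun _ => 1)
      (fun n => (hgm _ (hFK n)).aestronglyMeasurable) (integrable_const _) (fun n => ?_) hlim
    refine ae_of_all _ fun x => ?_
    rw [Real.norm_eq_abs, abs_of_pos (hg0 _ (hFK n) x)]; exact hg1 _ (hFK n) x
  refine ⟨G, hGm, fun x => ⟨hG0 x, hG1 x⟩, ?_, ?_, ?_⟩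
  · -- positivity
    have hA : MeasurableSet {x | G x = 0} := hGm (measurableSet_singleton 0)
    have key : m.real {x | G x = 0} ≤ 0 := by
      refine le_of_forall_pos_le_add fun ε hε => ?_
      obtain ⟨M, hM0, hM⟩ := ht ε hε
      have hl : Tendsto (fun n => (1 + M) * (∫ x in {x | G x = 0}, 1 / (1 + F n x) ∂m) + ε) atTop
          (nhds ((1 + M) * (∫ x in {x | G x = 0}, G x ∂m) + ε)) := by
        refine Tendsto.add_const _ (Tendsto.const_mul _ ?_)
        refine tendsto_integral_of_dominated_convergence (fun _ => 1)
          (fun n => (hgm _ (hFK n)).aestronglyMeasurable) (integrable_const _) (fun n => ?_)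
          (ae_restrict_of_ae hlim)
        refine ae_of_all _ fun x => ?_
        rw [Real.norm_eq_abs, abs_of_pos (hg0 _ (hFK n) x)]; exact hg1 _ (hFK n) x
      have hz : ∫ x in {x | G x = 0}, G x ∂m = 0 := by
        rw [setIntegral_congr_fun hA (g := fun _ => (0:ℝ)) (fun x hx => hx)]
        simp
      rw [hz, mul_zero] at hl
      refine ge_of_tendsto' hl (fun n => ?_)
      have hB : MeasurableSet {x | M ≤ F n x} := measurableSet_le measurable_const (hm _ (hFK n))
      have h1 := hM _ (hFK n)
      have h2 : m.real {x | G x = 0} = ∫ x, Set.indicator {x | G x = 0} (1 : X → ℝ) x ∂m :=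
        (integral_indicator_one hA).symm
      have h3 : m.real {x | M ≤ F n x} = ∫ x, Set.indicator {x | M ≤ F n x} (1 : X → ℝ) x ∂m :=
        (integral_indicator_one hB).symm
      have i1 : Integrable (Set.indicator {x | G x = 0} (1 : X → ℝ)) m :=
        (integrable_const (1:ℝ)).indicator hA
      have i2 : Integrable (Set.indicator {x | M ≤ F n x} (1 : X → ℝ)) m :=
        (integrable_const (1:ℝ)).indicator hB
      have i3 := (hgi _ (hFK n)).indicator hA
      rw [← integral_indicator hA, h2, ← integral_const_mul]
      refine le_trans ?_ (add_le_add_right (h3 ▸ h1) _)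
      rw [← integral_add (i3.const_mul _) i2]
      refine integral_mono i1 ((i3.const_mul _).add i2) (fun x => ?_)
      have a1 := hg0 _ (hFK n) x
      have a2 := h0 _ (hFK n) x
      by_cases c1 : G x = 0
      · by_cases c2 : M ≤ F n x
        · simp [Set.indicator, c1, c2]
          have := mul_pos (by linarith : 0 < 1 + M) a1
          rw [one_div] at this
          exact this.le
        · simp [Set.indicator, c1, c2]
          rw [← div_eq_mul_inv, one_le_div (by linarith)]
          push Not at c2
          linarith
      · by_cases c2 : M ≤ F n x
        · simp [Set.indicator, c1, c2]
        · simp [Set.indicator, c1, c2]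
    have h4 : m {x | G x = 0} = 0 := by
      have := le_antisymm key measureReal_nonneg
      rwa [measureReal_eq_zero_iff] at this
    have h5 : ∀ᵐ x ∂m, G x ≠ 0 := by
      rw [ae_iff]; simpa using h4
    filter_upwards [h5] with x hx
    exact lt_of_le_of_ne (hG0 x) (Ne.symm hx)
  · -- invariance
    intro b hb hbK
    have hlimb : ∀ᵐ x ∂m, Tendsto (fun n => 1 / (1 + F n (b x))) atTop (nhds (G (b x))) :=
      hb.quasiMeasurePreserving.ae hlim
    have hJb : ∀ n, J (F n ∘ b) = J (F n) := by
      intro n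
      have := integral_map (μ := m) hb.measurable.aemeasurable (f := fun x => 1 / (1 + F n x))
        (hgm _ (hFK n)).aestronglyMeasurable
      rw [hb.map_eq] at this
      exact this.symm
    have hl : Tendsto (fun n => ∫ x, (1 / (1 + F n x) - 1 / (1 + (F n ∘ b) x)) ^ 2 ∂m) atTop
        (nhds (∫ x, (G x - G (b x)) ^ 2 ∂m)) := by
      refine tendsto_integral_of_dominated_convergence (fun _ => 1)
        (fun n => (hsqi _ (hFK n) _ (hbK _ (hFK n))).aestronglyMeasurable)
        (integrable_const _) (fun n => ?_) ?_
      · refine ae_of_all _ fun x => ?_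
        have a1 := hg0 _ (hFK n) x
        have a2 := hg1 _ (hFK n) x
        have a3 := hg0 _ (hbK _ (hFK n)) x
        have a4 := hg1 _ (hbK _ (hFK n)) x
        rw [Real.norm_eq_abs, abs_of_nonneg (sq_nonneg _), sq_le_one_iff_abs_le_one, abs_le]
        constructor <;> linarith
      · filter_upwards [hlim, hlimb] with x h1 h2
        exact (h1.sub h2).pow 2
    have hle : ∫ x, (G x - G (b x)) ^ 2 ∂m ≤ 0 := by
      have hr : Tendsto (fun n => 2 * (J (F n) + J (F n)) - 4 * I) atTop
          (nhds (2 * (I + I) - 4 * I)) := ((hFJlim.add hFJlim).const_mul 2).sub_const _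
      have := le_of_tendsto_of_tendsto' hl hr (fun n => by
        have := hpar _ (hFK n) _ (hbK _ (hFK n))
        rwa [hJb] at this)
      linarith
    have hz : ∫ x, (G x - G (b x)) ^ 2 ∂m = 0 :=
      le_antisymm hle (integral_nonneg fun x => sq_nonneg _)
    rw [integral_eq_zero_iff_of_nonneg (fun x => sq_nonneg _)] at hz
    · filter_upwards [hz] with x hx
      have : G x - G (b x) = 0 := by simpa using hx
      linarith
    · refine mn_int m 1 ((hGm.sub (hGm.comp hb.measurable)).pow_const 2) (fun x => ?_)
      have a1 := hG0 x
      have a2 := hG1 x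
      have a3 := hG0 (b x)
      have a4 := hG1 (b x)
      rw [abs_of_nonneg (sq_nonneg _), sq_le_one_iff_abs_le_one, abs_le]
      constructor <;> linarith
  · -- bound
    intro F' hF'
    have hFz := h0 F' hF'
    have hFzm := hm F' hF'
    have hDpos : ∀ t : ℝ, 0 < t → t < 1 → ∀ g : ℝ, 0 ≤ g → ∀ x,
        0 < 1 - t + t * (g * (1 + F' x)) := by
      intro t t0 t1 g hg x
      have : 0 ≤ t * (g * (1 + F' x)) := by
        have := hFz x
        positivity
      linarith
    have hstep : ∀ t : ℝ, 0 < t → t < 1 →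
        ∫⁻ x, ENNReal.ofReal (G x * (G x * (1 + F' x)) / (1 - t + t * (G x * (1 + F' x)))) ∂m
          ≤ ENNReal.ofReal (1 / (1 - t)) := by
      intro t t0 t1
      have mD : Measurable (fun x => 1 - t + t * (G x * (1 + F' x))) := by fun_prop
      have iA : Integrable (fun x => G x / (1 - t + t * (G x * (1 + F' x)))) m := by
        refine mn_int m (1 / (1 - t)) (hGm.div mD) (fun x => ?_)
        have := hDpos t t0 t1 _ (hG0 x) x
        have hFx := hFz x
        have hGx := hG0 x
        rw [abs_of_nonneg (by positivity)]
        apply div_le_div₀ zero_le_one (hG1 x) (by linarith)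
        have : 0 ≤ t * (G x * (1 + F' x)) := by positivity
        linarith
      have iB : Integrable
          (fun x => G x * (G x * (1 + F' x)) / (1 - t + t * (G x * (1 + F' x)))) m := by
        refine mn_int m (1 / t) (by fun_prop) (fun x => ?_)
        have := hDpos t t0 t1 _ (hG0 x) x
        have hFx := hFz x
        have hGx := hG0 x
        have h3 := hG1 x
        rw [abs_of_nonneg (by positivity), div_le_div_iff₀ this t0]
        have hy : 0 ≤ G x * (1 + F' x) := by positivity
        nlinarith [mul_nonneg (mul_nonneg t0.le hy) (sub_nonneg.2 h3)]
      have hI1 : I ≤ ∫ x, G x / (1 - t + t * (G x * (1 + F' x))) ∂m := by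
        have hl : Tendsto (fun n => ∫ x, 1 / (1 + ((1 - t) • F n + t • F') x) ∂m) atTop
            (nhds (∫ x, G x / (1 - t + t * (G x * (1 + F' x))) ∂m)) := by
          have hmem : ∀ n, (1 - t) • F n + t • F' ∈ K := fun n =>
            hK (hFK n) hF' (by linarith) t0.le (by ring)
          refine tendsto_integral_of_dominated_convergence (fun _ => 1)
            (fun n => (hgm _ (hmem n)).aestronglyMeasurable) (integrable_const _) (fun n => ?_) ?_
          · refine ae_of_all _ fun x => ?_
            rw [Real.norm_eq_abs, abs_of_pos (hg0 _ (hmem n) x)]; exact hg1 _ (hmem n) x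
          · filter_upwards [hlim] with x hx
            have e : ∀ n, 1 / (1 + ((1 - t) • F n + t • F') x) =
                (1 / (1 + F n x)) / (1 - t + t * ((1 / (1 + F n x)) * (1 + F' x))) := by
              intro n
              have a1 := h0 _ (hFK n) x
              have a2 := hDpos t t0 t1 _ (hg0 _ (hFK n) x).le x
              have a3 := h0 _ (hmem n) x
              rw [div_div]
              congr 1
              simp only [Pi.add_apply, Pi.smul_apply, smul_eq_mul]
              field_simp
              ring
            simp_rw [e]
            exact hx.div (((hx.mul_const _).const_mul t).const_add _)
              (hDpos t t0 t1 _ (hG0 x) x).ne'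
        refine ge_of_tendsto' hl (fun n => ?_)
        exact hIle _ (hK (hFK n) hF' (by linarith) t0.le (by ring))
      have hsum : I = (1 - t) * ∫ x, G x / (1 - t + t * (G x * (1 + F' x))) ∂m
          + t * ∫ x, G x * (G x * (1 + F' x)) / (1 - t + t * (G x * (1 + F' x))) ∂m := by
        rw [← hGI, ← integral_const_mul, ← integral_const_mul,
          ← integral_add (iA.const_mul _) (iB.const_mul _)]
        refine integral_congr_ae (ae_of_all _ fun x => ?_)
        have := hDpos t t0 t1 _ (hG0 x) x
        have e3 : (1 - t) * (G x / (1 - t + t * (G x * (1 + F' x)))) +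
            t * (G x * (G x * (1 + F' x)) / (1 - t + t * (G x * (1 + F' x)))) =
            G x * (1 - t + t * (G x * (1 + F' x))) / (1 - t + t * (G x * (1 + F' x))) := by ring
        simp only
        rw [e3, mul_div_assoc, div_self this.ne', mul_one]
      have hAle : ∫ x, G x / (1 - t + t * (G x * (1 + F' x))) ∂m ≤ 1 / (1 - t) := by
        have : ∫ x, G x / (1 - t + t * (G x * (1 + F' x))) ∂m ≤ ∫ x, 1 / (1 - t) ∂m := by
          refine integral_mono iA (integrable_const _) (fun x => ?_)
          have hFx := hFz x
          have hGx := hG0 x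
          apply div_le_div₀ zero_le_one (hG1 x) (by linarith)
          have : 0 ≤ t * (G x * (1 + F' x)) := by positivity
          linarith
        simpa using this
      rw [← ofReal_integral_eq_lintegral_ofReal iB]
      · apply ENNReal.ofReal_le_ofReal
        refine le_trans ?_ hAle
        by_contra hc
        push Not at hc
        nlinarith
      · refine ae_of_all _ fun x => ?_
        have := hDpos t t0 t1 _ (hG0 x) x
        have hFx := hFz x
        have hGx := hG0 x
        show 0 ≤ _
        positivity
    set t : ℕ → ℝ := fun n => 1 / ((n : ℝ) + 1 + 1) with htdef
    have t0 : ∀ n, 0 < t n := fun n => by simp only [htdef]; positivity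
    have t1 : ∀ n, t n < 1 := fun n => by
      simp only [htdef]; rw [div_lt_one (by positivity)]
      have : (0:ℝ) ≤ n := n.cast_nonneg
      linarith
    have tl : Tendsto t atTop (nhds 0) := by
      have := (tendsto_add_atTop_iff_nat 1).2 (tendsto_one_div_add_atTop_nhds_zero_nat (𝕜 := ℝ))
      simpa [htdef] using this
    have hfat := lintegral_liminf_le (μ := m) (u := atTop) (f := fun n x => ENNReal.ofReal
      (G x * (G x * (1 + F' x)) / (1 - t n + t n * (G x * (1 + F' x)))))
      (fun n => by fun_prop)
    have hR : liminf (fun n => ∫⁻ x, ENNReal.ofReal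
        (G x * (G x * (1 + F' x)) / (1 - t n + t n * (G x * (1 + F' x)))) ∂m) atTop ≤ 1 := by
      have hl : Tendsto (fun n => ENNReal.ofReal (1 / (1 - t n))) atTop (nhds 1) := by
        have : Tendsto (fun n => 1 / (1 - t n)) atTop (nhds (1 / (1 - 0))) :=
          tendsto_const_nhds.div (tl.const_sub 1) (by norm_num)
        simpa using ENNReal.tendsto_ofReal this
      rw [← hl.liminf_eq]
      exact liminf_le_liminf (Eventually.of_forall fun n => hstep _ (t0 n) (t1 n))
    refine le_trans ?_ (hfat.trans hR)
    refine lintegral_mono fun x => ?_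
    have hl : Tendsto (fun n => ENNReal.ofReal
        (G x * (G x * (1 + F' x)) / (1 - t n + t n * (G x * (1 + F' x))))) atTop
        (nhds (ENNReal.ofReal (G x * (G x * (1 + F' x)) / (1 - 0 + 0 * (G x * (1 + F' x)))))) := by
      refine ENNReal.tendsto_ofReal ?_
      exact tendsto_const_nhds.div ((tl.const_sub 1).add (tl.mul_const _)) (by norm_num)
    rw [hl.liminf_eq]
    apply ENNReal.ofReal_le_ofReal
    have hGx := hG0 x
    simp
    nlinarith [mul_nonneg hGx hGx]
end

/-- Rademacher average over all signs. -/
noncomputable def mnR {E : Type*} [AddCommGroup E] : List E → (E → ℝ) → E → ℝ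
  | [], f, ξ => f ξ
  | a :: l, f, ξ => (mnR l f (ξ + a) + mnR l f (ξ - a)) / 2

theorem mnR_mono {E : Type*} [AddCommGroup E] (l : List E) (f g : E → ℝ) (h : ∀ x, f x ≤ g x) :
    ∀ ξ, mnR l f ξ ≤ mnR l g ξ := by
  induction l with
  | nil => exact h
  | cons a l ih => intro ξ; simp only [mnR]; linarith [ih (ξ + a), ih (ξ - a)]

theorem mnR_norm {H : Type*} [NormedAddCommGroup H] [InnerProductSpace ℝ H] (p q : ℝ) (l : List H) :
    ∀ ξ, mnR l (fun η => p + q * ‖η‖ ^ 2) ξ = p + q * (‖ξ‖ ^ 2 + (l.map (fun a => ‖a‖ ^ 2)).sum) := by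
  induction l with
  | nil => intro ξ; simp [mnR]
  | cons a l ih =>
    intro ξ; simp only [mnR, ih, List.map_cons, List.sum_cons]
    have := parallelogram_law_with_norm ℝ ξ a
    linear_combination (q / 2) * this

theorem mnR_four (p q : ℝ) (r : ℝ) (hr : 0 ≤ r) (l : List ℝ) :
    ∀ x, p + q * (x ^ 2 + (l.map (fun a => a ^ 2)).sum) - r * (x ^ 4 +
      6 * x ^ 2 * (l.map (fun a => a ^ 2)).sum + 3 * (l.map (fun a => a ^ 2)).sum ^ 2)
      ≤ mnR l (fun y => p + q * y ^ 2 - r * y ^ 4) x := by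
  induction l with
  | nil => intro x; simp [mnR]
  | cons a l ih =>
    intro x; simp only [mnR, List.map_cons, List.sum_cons]
    have h1 := ih (x + a)
    have h2 := ih (x - a)
    have h3 : 0 ≤ r * a ^ 4 := by positivity
    nlinarith

theorem mnR_pz (l : List ℝ) (M : ℝ) (hM : 0 < M) (hQ : M ≤ (l.map (fun a => a ^ 2)).sum) :
    1 / 12 ≤ mnR l (Set.indicator {y : ℝ | M / 2 ≤ y ^ 2} 1) 0 := by
  set Q := (l.map (fun a => a ^ 2)).sum with hQd
  have hQ0 : 0 < Q := by linarith
  have h1 := mnR_four (-1/6) (1 / (3 * Q)) (1 / (36 * Q ^ 2)) (by positivity) l 0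
  rw [← hQd] at h1
  have e : -1/6 + 1 / (3 * Q) * ((0:ℝ) ^ 2 + Q) - 1 / (36 * Q ^ 2) * (0 ^ 4 + 6 * 0 ^ 2 * Q + 3 * Q ^ 2)
      = 1 / 12 := by field_simp; ring
  rw [e] at h1
  refine h1.trans (mnR_mono _ _ _ (fun y => ?_) _)
  obtain ⟨z, hz⟩ : ∃ z, z = y ^ 2 / Q := ⟨_, rfl⟩
  have hy : y ^ 2 = z * Q := by rw [hz]; field_simp
  have e2 : -1/6 + 1 / (3 * Q) * y ^ 2 - 1 / (36 * Q ^ 2) * y ^ 4 = -1/6 + z / 3 - z ^ 2 / 36 := by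
    have : y ^ 4 = (z * Q) ^ 2 := by rw [← hy]; ring
    rw [this, hy]; field_simp
  rw [e2]
  by_cases hc : M / 2 ≤ y ^ 2
  · simp only [Set.indicator, Set.mem_ofPred_eq, hc, if_true, Pi.one_apply]
    nlinarith [sq_nonneg (z - 6)]
  · simp only [Set.indicator, Set.mem_ofPred_eq, hc, if_false]
    have : z < 1 / 2 := by
      push Not at hc
      by_contra h
      push Not at h
      nlinarith
    nlinarith [sq_nonneg z]

section
variable {H : Type*} [NormedAddCommGroup H] [InnerProductSpace ℝ H]
    {X : Type*} [MeasurableSpace X] (m : Measure X) [IsProbabilityMeasure m]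
    (T : H → X → ℝ)

theorem mn_sub
    (hT_add : ∀ ξ η, T (ξ + η) =ᵐ[m] fun x => T ξ x + T η x)
    (hT_smul : ∀ (r : ℝ) (ξ : H), T (r • ξ) =ᵐ[m] fun x => r * T ξ x)
    (ξ η : H) : T (ξ - η) =ᵐ[m] fun x => T ξ x - T η x := by
  have h1 := hT_add ξ ((-1 : ℝ) • η)
  have h2 := hT_smul (-1) η
  have e : ξ - η = ξ + (-1 : ℝ) • η := by simp [sub_eq_add_neg]
  rw [e]
  filter_upwards [h1, h2] with x a b
  rw [a, b]; ring

theorem mnR_int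
    (hT_meas : ∀ ξ, Measurable (T ξ))
    (hT_add : ∀ ξ η, T (ξ + η) =ᵐ[m] fun x => T ξ x + T η x)
    (hT_smul : ∀ (r : ℝ) (ξ : H), T (r • ξ) =ᵐ[m] fun x => r * T ξ x)
    (S : Set ℝ) (hS : MeasurableSet S) (l : List H) : ∀ ξ,
    Integrable (fun x => mnR (l.map (fun a => T a x)) (Set.indicator S 1) (T ξ x)) m ∧
    ∫ x, mnR (l.map (fun a => T a x)) (Set.indicator S 1) (T ξ x) ∂m =
      mnR l (fun η => m.real (T η ⁻¹' S)) ξ := by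
  induction l with
  | nil =>
    intro ξ
    simp only [List.map_nil, mnR]
    have e : (fun x => Set.indicator S (1 : ℝ → ℝ) (T ξ x)) =
      Set.indicator (T ξ ⁻¹' S) (1 : X → ℝ) := by ext x; simp [Set.indicator]; rfl
    rw [e]
    exact ⟨(integrable_const (1:ℝ)).indicator (hT_meas ξ hS),
      integral_indicator_one (hT_meas ξ hS)⟩
  | cons a l ih =>
    intro ξ
    obtain ⟨i1, e1⟩ := ih (ξ + a)
    obtain ⟨i2, e2⟩ := ih (ξ - a)
    have hae : (fun x => mnR ((a :: l).map (fun a => T a x)) (Set.indicator S 1) (T ξ x)) =ᵐ[m]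
        fun x => (mnR (l.map (fun a => T a x)) (Set.indicator S 1) (T (ξ + a) x) +
          mnR (l.map (fun a => T a x)) (Set.indicator S 1) (T (ξ - a) x)) / 2 := by
      filter_upwards [hT_add ξ a, mn_sub m T hT_add hT_smul ξ a] with x h1 h2
      simp only [List.map_cons, mnR, h1, h2]
    refine ⟨((i1.add i2).div_const 2).congr hae.symm, ?_⟩
    rw [integral_congr_ae hae, integral_div, integral_add i1 i2, e1, e2]
    simp only [mnR]

theorem mn_zero
    (hT_smul : ∀ (r : ℝ) (ξ : H), T (r • ξ) =ᵐ[m] fun x => r * T ξ x)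
    : T 0 =ᵐ[m] fun _ => 0 := by
  have := hT_smul 0 0
  simpa using this

theorem mn_delta
    (hT_smul : ∀ (r : ℝ) (ξ : H), T (r • ξ) =ᵐ[m] fun x => r * T ξ x)
    (hT_cont : ∀ (ξs : ℕ → H) (ξ : H), Tendsto ξs atTop (nhds ξ) →
      TendstoInMeasure m (fun n => T (ξs n)) atTop (T ξ))
    (ε : ℝ) (hε : 0 < ε) : ∃ δ > 0, ∀ η, ‖η‖ ≤ δ → m.real {x | 1 ≤ |T η x|} ≤ ε := by
  by_contra hc
  push Not at hc
  have : ∀ n : ℕ, ∃ η, ‖η‖ ≤ 1 / ((n:ℝ) + 1) ∧ ε < m.real {x | 1 ≤ |T η x|} :=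
    fun n => hc _ (by positivity)
  choose η h1 h2 using this
  have hl : Tendsto η atTop (nhds 0) :=
    squeeze_zero_norm h1 tendsto_one_div_add_atTop_nhds_zero_nat
  have h3 := (tendstoInMeasure_iff_measureReal_norm.1 (hT_cont η 0 hl)) 1 one_pos
  have h4 : ∀ n, m.real {x | 1 ≤ ‖T (η n) x - T 0 x‖} = m.real {x | 1 ≤ |T (η n) x|} := by
    intro n
    refine measureReal_congr ?_
    filter_upwards [mn_zero m T hT_smul] with x hx
    apply propext
    show 1 ≤ ‖T (η n) x - T 0 x‖ ↔ 1 ≤ |T (η n) x|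
    rw [hx, sub_zero, Real.norm_eq_abs]
  simp_rw [h4] at h3
  have := ge_of_tendsto' h3 (fun n => (h2 n).le)
  linarith

theorem mn_tight
    (hT_meas : ∀ ξ, Measurable (T ξ))
    (hT_add : ∀ ξ η, T (ξ + η) =ᵐ[m] fun x => T ξ x + T η x)
    (hT_smul : ∀ (r : ℝ) (ξ : H), T (r • ξ) =ᵐ[m] fun x => r * T ξ x)
    (hT_cont : ∀ (ξs : ℕ → H) (ξ : H), Tendsto ξs atTop (nhds ξ) →
      TendstoInMeasure m (fun n => T (ξs n)) atTop (T ξ))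
    (C : ℝ) (ε : ℝ) (hε : 0 < ε) : ∃ M : ℝ, 0 ≤ M ∧ ∀ l : List H,
    (l.map (fun a => ‖a‖ ^ 2)).sum ≤ C →
      m.real {x | M ≤ (l.map (fun a => T a x ^ 2)).sum} ≤ ε := by
  obtain ⟨δ, hδ, hd⟩ := mn_delta m T hT_smul hT_cont (ε / 24) (by positivity)
  set D := max C 1 with hD
  have hD1 : 1 ≤ D := le_max_right _ _
  set M := 48 * D / (ε * δ ^ 2) with hM
  have hM0 : 0 < M := by positivity
  refine ⟨M, hM0.le, fun l hl => ?_⟩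
  set S : Set ℝ := {y : ℝ | M / 2 ≤ y ^ 2} with hS
  have hSm : MeasurableSet S := measurableSet_le measurable_const (by fun_prop)
  obtain ⟨i1, e1⟩ := mnR_int m T hT_meas hT_add hT_smul S hSm l 0
  have hN : ∀ η, m.real (T η ⁻¹' S) ≤ ε / 24 + (2 / (M * δ ^ 2)) * ‖η‖ ^ 2 := by
    intro η
    by_cases hc : ‖η‖ ≤ √(M / 2) * δ
    · have h1 := hd ((√(M / 2))⁻¹ • η) (by
        rw [norm_smul, Real.norm_eq_abs, abs_of_pos (by positivity)]
        rw [inv_mul_le_iff₀ (by positivity)]; exact hc)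
      have h2 : m.real {x | 1 ≤ |T ((√(M / 2))⁻¹ • η) x|} = m.real (T η ⁻¹' S) := by
        refine measureReal_congr ?_
        filter_upwards [hT_smul ((√(M / 2))⁻¹) η] with x hx
        apply propext
        show 1 ≤ |T ((√(M / 2))⁻¹ • η) x| ↔ M / 2 ≤ T η x ^ 2
        rw [hx, abs_mul, abs_of_pos (by positivity), le_inv_mul_iff₀ (by positivity), mul_one,
          ← Real.sqrt_sq_eq_abs, Real.sqrt_le_sqrt_iff (sq_nonneg _)]
      rw [← h2]
      have : 0 ≤ (2 / (M * δ ^ 2)) * ‖η‖ ^ 2 := by positivity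
      linarith
    · push Not at hc
      have h1 : (√(M / 2) * δ) ^ 2 ≤ ‖η‖ ^ 2 := by
        apply pow_le_pow_left₀ (by positivity) hc.le
      rw [mul_pow, Real.sq_sqrt (by positivity)] at h1
      have h2 : 1 ≤ (2 / (M * δ ^ 2)) * ‖η‖ ^ 2 := by
        rw [div_mul_eq_mul_div, one_le_div (by positivity)]
        linarith
      have h3 : m.real (T η ⁻¹' S) ≤ 1 := measureReal_le_one
      have : 0 < ε / 24 := by positivity
      linarith
  have h5 := mnR_mono l _ _ hN 0
  rw [mnR_norm, ← e1] at h5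
  have hSet : MeasurableSet {x | M ≤ (l.map (fun a => T a x ^ 2)).sum} := by
    refine measurableSet_le measurable_const ?_
    clear hl i1 e1 h5
    induction l with
    | nil => simp
    | cons a l ih =>
      simp only [List.map_cons, List.sum_cons]
      exact ((hT_meas a).pow_const 2).add ih
  have h6 : m.real {x | M ≤ (l.map (fun a => T a x ^ 2)).sum} / 12 ≤
      ∫ x, mnR (l.map (fun a => T a x)) (Set.indicator S 1) (T 0 x) ∂m := by
    rw [← integral_indicator_one hSet, ← integral_div]
    refine integral_mono_ae (((integrable_const (1:ℝ)).indicator hSet).div_const 12) i1 ?_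
    filter_upwards [mn_zero m T hT_smul] with x hx
    rw [hx]
    by_cases hc : M ≤ (l.map (fun a => T a x ^ 2)).sum
    · simp only [Set.indicator, Set.mem_ofPred_eq, hc, if_true, Pi.one_apply]
      refine mnR_pz _ M hM0 ?_
      simpa [List.map_map, Function.comp_def] using hc
    · simp only [Set.indicator, Set.mem_ofPred_eq, hc, if_false, zero_div]
      have h7 := mnR_mono (l.map (fun a => T a x)) (fun y => 0 + 0 * ‖y‖ ^ 2)
        (Set.indicator S 1) (fun y => by
          simp only [zero_mul, add_zero]
          exact Set.indicator_nonneg (fun _ _ => zero_le_one) y) 0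
      rw [mnR_norm] at h7
      simpa using h7
  have h8 : 2 / (M * δ ^ 2) * (‖(0:H)‖ ^ 2 + (l.map (fun a => ‖a‖ ^ 2)).sum) ≤ ε / 24 := by
    have : 2 / (M * δ ^ 2) = ε / (24 * D) := by rw [hM]; field_simp; norm_num
    rw [this, norm_zero]
    have h9 : (l.map (fun a => ‖a‖ ^ 2)).sum ≤ D := hl.trans (le_max_left _ _)
    calc ε / (24 * D) * (0 ^ 2 + (l.map (fun a => ‖a‖ ^ 2)).sum) ≤ ε / (24 * D) * D := by
          gcongr; linarith
      _ = ε / 24 := by field_simp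
  linarith
end





/-- Equivariant Maurey–Nikishin factorization.  Let `π : Γ → GL(H)` be a
uniformly bounded representation of a countable group on a separable real Hilbert space, let
`β` be a measure-preserving action of `Γ` on a probability space `(X,m)`, and let
`T : H → L⁰(X,m)` be an `ℝ`-linear map, continuous in measure and equivariant.  Then there is
a bounded measurable `Γ`-invariant function `φ : X → ℝ`, a.e. positive, with
`∫ φ (Tξ)² dm ≤ ‖ξ‖²` for all `ξ`. -/
theorem stmt6 {Γ : Type*} [Group Γ] [Countable Γ]
    {H : Type*} [NormedAddCommGroup H] [InnerProductSpace ℝ H] [CompleteSpace H]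
    [TopologicalSpace.SeparableSpace H]
    {X : Type*} [MeasurableSpace X] (m : Measure X) [IsProbabilityMeasure m]
    (π : Γ →* (H →L[ℝ] H)ˣ)
    (hub : ∃ C : ℝ, ∀ s : Γ, ‖(π s : H →L[ℝ] H)‖ ≤ C)
    (β : Γ → X → X)
    (hβ_meas : ∀ s, Measurable (β s))
    (hβ_one : ∀ x, β 1 x = x)
    (hβ_mul : ∀ s t x, β (s * t) x = β s (β t x))
    (hβ_mp : ∀ s, MeasurePreserving (β s) m m)
    (T : H → X → ℝ)
    (hT_meas : ∀ ξ, Measurable (T ξ))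
    (hT_add : ∀ ξ η, T (ξ + η) =ᵐ[m] fun x => T ξ x + T η x)
    (hT_smul : ∀ (r : ℝ) (ξ : H), T (r • ξ) =ᵐ[m] fun x => r * T ξ x)
    (hT_cont : ∀ (ξs : ℕ → H) (ξ : H), Tendsto ξs atTop (nhds ξ) →
      TendstoInMeasure m (fun n => T (ξs n)) atTop (T ξ))
    (hT_equiv : ∀ (s : Γ) (ξ : H), ∀ᵐ x ∂m,
      T ((π s : H →L[ℝ] H) ξ) x = T ξ (β s⁻¹ x)) :
    ∃ φ : X → ℝ, Measurable φ ∧ (∃ Cb : ℝ, ∀ x, |φ x| ≤ Cb) ∧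
      (∀ᵐ x ∂m, 0 < φ x) ∧
      (∀ s : Γ, (fun x => φ (β s x)) =ᵐ[m] φ) ∧
      ∀ ξ : H, ∫⁻ x, ENNReal.ofReal (φ x * T ξ x ^ 2) ∂m ≤ ENNReal.ofReal (‖ξ‖ ^ 2) := by
  classical
  obtain ⟨C, hC⟩ := hub
  set K0 : Set (X → ℝ) := {F | ∃ (s : Γ) (ξ : H), ‖ξ‖ ≤ 1 ∧ F = fun x => T ξ (β s x) ^ 2} with hK0
  have hrep : convexHull ℝ K0 ⊆ {F | ∃ l : List H, (l.map (fun a => ‖a‖ ^ 2)).sum ≤ C ^ 2 ∧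
      F =ᵐ[m] fun x => (l.map (fun a => T a x ^ 2)).sum} := by
    refine convexHull_min ?_ ?_
    · rintro F ⟨s, ξ, hξ, rfl⟩
      refine ⟨[(π s⁻¹ : H →L[ℝ] H) ξ], ?_, ?_⟩
      · simp only [List.map_cons, List.map_nil, List.sum_cons, List.sum_nil, add_zero]
        have h1 := (π s⁻¹ : H →L[ℝ] H).le_opNorm ξ
        have h2 : ‖(π s⁻¹ : H →L[ℝ] H)‖ * ‖ξ‖ ≤ C := by
          refine le_trans (mul_le_of_le_one_right (norm_nonneg _) hξ) (hC _)
        exact pow_le_pow_left₀ (norm_nonneg _) (h1.trans h2) 2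
      · filter_upwards [hT_equiv s⁻¹ ξ] with x hx
        rw [inv_inv] at hx
        simp only [List.map_cons, List.map_nil, List.sum_cons, List.sum_nil, add_zero, hx]
    · rintro F ⟨l, hl, hF⟩ F' ⟨l', hl', hF'⟩ a b ha hb hab
      refine ⟨l.map (fun ξ => √a • ξ) ++ l'.map (fun ξ => √b • ξ), ?_, ?_⟩
      · have e : ∀ (a : ℝ), 0 ≤ a → ∀ l : List H,
            ((l.map (fun ξ => √a • ξ)).map (fun a => ‖a‖ ^ 2)).sum =
              a * (l.map (fun a => ‖a‖ ^ 2)).sum := by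
          intro a ha l
          rw [List.map_map, ← List.sum_map_mul_left]
          congr 2
          ext ξ
          simp [norm_smul, mul_pow, Real.sq_sqrt ha]
        rw [List.map_append, List.sum_append, e a ha, e b hb]
        nlinarith
      · have e : ∀ (a : ℝ), 0 ≤ a → ∀ l : List H,
            (fun x => ((l.map (fun ξ => √a • ξ)).map (fun a => T a x ^ 2)).sum) =ᵐ[m]
              fun x => a * (l.map (fun a => T a x ^ 2)).sum := by
          intro a ha l
          induction l with
          | nil => simp
          | cons ξ l ih =>
            filter_upwards [ih, hT_smul (√a) ξ] with x h1 h2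
            simp only [List.map_cons, List.sum_cons]
            rw [h1, h2, mul_pow, Real.sq_sqrt ha]
            ring
        filter_upwards [hF, hF', e a ha l, e b hb l'] with x h1 h2 h3 h4
        rw [List.map_append, List.sum_append, h3, h4]
        simp [h1, h2]
  have hK0m : ∀ F ∈ convexHull ℝ K0, Measurable F := by
    refine convexHull_min (t := {F | Measurable F}) ?_ ?_
    · rintro F ⟨s, ξ, hξ, rfl⟩
      exact ((hT_meas ξ).comp (hβ_meas s)).pow_const 2
    · intro F hF F' hF' a b ha hb hab
      exact (Measurable.const_smul hF a).add (Measurable.const_smul hF' b)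
  have hK00 : ∀ F ∈ convexHull ℝ K0, ∀ x, 0 ≤ F x := by
    refine convexHull_min (t := {F : X → ℝ | ∀ x, 0 ≤ F x}) ?_ ?_
    · rintro F ⟨s, ξ, hξ, rfl⟩ x
      exact sq_nonneg _
    · intro F hF F' hF' a b ha hb hab x
      exact add_nonneg (mul_nonneg ha (hF x)) (mul_nonneg hb (hF' x))
  have hinv : ∀ s, ∀ F ∈ convexHull ℝ K0, F ∘ β s ∈ convexHull ℝ K0 := by
    intro s
    refine convexHull_min (t := {F | F ∘ β s ∈ convexHull ℝ K0}) ?_ ?_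
    · rintro F ⟨t, ξ, hξ, rfl⟩
      refine subset_convexHull ℝ K0 ⟨t * s, ξ, hξ, ?_⟩
      ext x
      simp [hβ_mul]
    · intro F hF F' hF' a b ha hb hab
      exact convex_convexHull ℝ K0 hF hF' ha hb hab
  have hmem : ∀ ξ : H, ‖ξ‖ ≤ 1 → (fun x => T ξ x ^ 2) ∈ convexHull ℝ K0 := fun ξ hξ =>
    subset_convexHull ℝ K0 ⟨1, ξ, hξ, by simp [hβ_one]⟩
  obtain ⟨G, hGm, hG01, hGpos, hGinv, hGb⟩ := mn_abstract m (convexHull ℝ K0)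
    ⟨_, hmem 0 (by simp)⟩ (convex_convexHull ℝ K0) hK0m hK00 (by
      intro ε hε
      obtain ⟨M, hM0, hM⟩ := mn_tight m T hT_meas hT_add hT_smul hT_cont (C ^ 2) ε hε
      refine ⟨M, hM0, fun F hF => ?_⟩
      obtain ⟨l, hl, hFl⟩ := hrep hF
      refine le_trans (le_of_eq (measureReal_congr ?_)) (hM l hl)
      filter_upwards [hFl] with x hx
      apply propext
      show M ≤ F x ↔ M ≤ _
      rw [hx])
  refine ⟨fun x => G x ^ 2, hGm.pow_const 2, ⟨1, fun x => ?_⟩, ?_, ?_, ?_⟩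
  · rw [abs_of_nonneg (sq_nonneg _)]
    exact pow_le_one₀ (hG01 x).1 (hG01 x).2
  · filter_upwards [hGpos] with x hx
    positivity
  · intro s
    filter_upwards [hGinv (β s) (hβ_mp s) (hinv s)] with x hx
    simp only [hx]
  · intro ξ
    by_cases hξ : ξ = 0
    · subst hξ
      have : (fun x => ENNReal.ofReal (G x ^ 2 * T 0 x ^ 2)) =ᵐ[m] fun _ => 0 := by
        filter_upwards [mn_zero m T hT_smul] with x hx
        simp [hx]
      rw [lintegral_congr_ae this]
      simp
    · have hn : 0 < ‖ξ‖ := norm_pos_iff.2 hξ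
      have h1 := hGb _ (hmem (‖ξ‖⁻¹ • ξ) (by
        rw [norm_smul, norm_inv, norm_norm, inv_mul_cancel₀ hn.ne']))
      have : (fun x => ENNReal.ofReal (G x ^ 2 * T ξ x ^ 2)) =ᵐ[m] fun x =>
          ENNReal.ofReal (‖ξ‖ ^ 2) * ENNReal.ofReal (G x ^ 2 * T (‖ξ‖⁻¹ • ξ) x ^ 2) := by
        filter_upwards [hT_smul (‖ξ‖⁻¹) ξ] with x hx
        rw [← ENNReal.ofReal_mul (sq_nonneg _), hx]
        congr 1
        field_simp
      rw [lintegral_congr_ae this, lintegral_const_mul' _ _ ENNReal.ofReal_ne_top]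
      exact mul_le_of_le_one_right zero_le h1
end

section
/- Let Γ be a countable discrete group acting on a probability space (X,m) by measure-preserving measurable bijections β(s), s ∈ Γ. Let A be a convex subset of the set of m-a.e. nonnegative functions in L⁰(X,m) that is globally Γ-invariant, i.e. φ ∈ A and s ∈ Γ imply φ ∘ β(s)⁻¹ ∈ A. Then for every ε > 0 there exists a measurable subset S(ε) ⊆ X that is Γ-invariant (m(β(s)⁻¹S(ε) Δ S(ε)) = 0 for every s ∈ Γ), with m(X \ S(ε)) ≤ ε, such that sup_{φ∈A} ∫_{S(ε)} φ(x) dm(x) ≤ 2 · sup_{φ∈A} φ⋆(ε/2) (an inequality in [0,∞]). -/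
open MeasureTheory

/-- The non-increasing rearrangement `φ⋆(t) = inf {λ > 0 | m {x | |φ x| > λ} ≤ t}`. -/
noncomputable def rearr {X : Type*} [MeasurableSpace X] (m : Measure X)
    (φ : X → ℝ) (t : ℝ) : ℝ :=
  sInf {l : ℝ | 0 < l ∧ m {x | l < |φ x|} ≤ ENNReal.ofReal t}


section helpers
open scoped RealInnerProductSpace

lemma aux_minimax {H : Type*} [NormedAddCommGroup H] [InnerProductSpace ℝ H] [CompleteSpace H]
    (P : Set (H × ℝ)) (R : ℝ) (hR : ∀ g : H, (∀ p ∈ P, ⟪p.1, g⟫ ≤ p.2) → ‖g‖ ≤ R)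
    (hne : ∃ g : H, ∀ p ∈ P, ⟪p.1, g⟫ ≤ p.2)
    (Y : Set H) (hY : Convex ℝ Y) (M : ℝ)
    (h : ∀ b ∈ Y, ∃ g : H, (∀ p ∈ P, ⟪p.1, g⟫ ≤ p.2) ∧ ⟪b, g⟫ ≤ M) :
    ∃ g : H, (∀ p ∈ P, ⟪p.1, g⟫ ≤ p.2) ∧ ∀ b ∈ Y, ⟪b, g⟫ ≤ M := by
  let T : H → WeakDual ℝ H := fun g => StrongDual.toWeakDual (InnerProductSpace.toDual ℝ H g)
  have hT : ∀ g b, T g b = ⟪b, g⟫ := by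
    intro g b
    change InnerProductSpace.toDual ℝ H g b = _
    rw [InnerProductSpace.toDual_apply_apply, real_inner_comm]
  let T' : WeakDual ℝ H → H := fun x =>
    (InnerProductSpace.toDual ℝ H).symm (WeakDual.toStrongDual x)
  have hT' : ∀ x b, ⟪b, T' x⟫ = x b := by
    intro x b
    rw [real_inner_comm]
    exact InnerProductSpace.toDual_symm_apply
  let X : Set (WeakDual ℝ H) := {x | ∀ p ∈ P, x p.1 ≤ p.2}
  have hev : ∀ b : H, Continuous fun x : WeakDual ℝ H => x b := fun b => WeakDual.eval_continuous b
  have hXclosed : IsClosed X := by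
    have : X = ⋂ p ∈ P, {x : WeakDual ℝ H | x p.1 ≤ p.2} := by ext; simp [X]
    rw [this]
    exact isClosed_biInter fun p _ => isClosed_le (hev p.1) continuous_const
  have hXbd : X ⊆ WeakDual.toStrongDual ⁻¹' Metric.closedBall 0 R := by
    intro x hx
    have h1 := hR (T' x) (fun p hp => by rw [hT']; exact hx p hp)
    simp only [Set.mem_preimage, mem_closedBall_zero_iff]
    simpa [T'] using h1
  have hXc : IsCompact X := (WeakDual.isCompact_closedBall 0 R).of_isClosed_subset hXclosed hXbd
  have hXne : X.Nonempty := by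
    obtain ⟨g, hg⟩ := hne
    exact ⟨T g, fun p hp => by rw [hT]; exact hg p hp⟩
  have hXconv : Convex ℝ X := by
    intro x hx y hy a b ha hb hab p hp
    have h1 := hx p hp
    have h2 := hy p hp
    change a * x p.1 + b * y p.1 ≤ p.2
    calc a * x p.1 + b * y p.1 ≤ a * p.2 + b * p.2 := by gcongr
      _ = p.2 := by rw [← add_mul, hab, one_mul]
  by_contra hcon
  push Not at hcon
  have hempty : X ∩ ⋂ b : Y, {x : WeakDual ℝ H | x b.1 ≤ M} = ∅ := by
    rw [Set.eq_empty_iff_forall_notMem]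
    rintro x ⟨hx, hx2⟩
    obtain ⟨b, hb, hlt⟩ := hcon (T' x) (fun p hp => by rw [hT']; exact hx p hp)
    rw [hT'] at hlt
    have := Set.mem_iInter.1 hx2 ⟨b, hb⟩
    exact absurd this (not_le.2 hlt)
  obtain ⟨u, hu⟩ := hXc.elim_finite_subfamily_closed
    (fun b : Y => {x : WeakDual ℝ H | x b.1 ≤ M})
    (fun b => isClosed_le (hev b.1) continuous_const) hempty
  obtain ⟨y0, hy0, hlt⟩ := Sion.exists_lt_iInf_of_lt_iInf_of_finite (X := X) (Y := Y)
    (f := fun x b => x b) hXne hXc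
    (fun y _ => (hev y).lowerSemicontinuous.lowerSemicontinuousOn _)
    (fun y _ => by
      apply ConvexOn.quasiconvexOn
      refine ⟨hXconv, ?_⟩
      intro x _ z _ a b _ _ _
      exact le_rfl)
    hY
    (fun x _ => x.continuous.upperSemicontinuous.upperSemicontinuousOn _)
    (fun x _ => by
      apply ConcaveOn.quasiconcaveOn
      refine ⟨hY, ?_⟩
      intro y _ z _ a b _ _ _
      simp)
    hXconv (s := Set.image (fun b : Y => b.1) (u : Set Y)) (u.finite_toSet.image _)
    (by rintro _ ⟨b, _, rfl⟩; exact b.2) (t := M)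
    (by
      intro x hx
      by_contra hc
      push Not at hc
      have : x ∈ X ∩ ⋂ b ∈ u, {x : WeakDual ℝ H | x b.1 ≤ M} := by
        refine ⟨hx, Set.mem_iInter₂.2 fun b hb => hc _ ⟨b, hb, rfl⟩⟩
      rw [hu] at this
      exact this)
  obtain ⟨g, hg, hgM⟩ := h y0 hy0
  have := hlt (T g) (fun p hp => by rw [hT]; exact hg p hp)
  simp only [hT] at this
  exact absurd hgM (not_le.2 this)

lemma aux_minnorm {H : Type*} [NormedAddCommGroup H] [InnerProductSpace ℝ H] [CompleteSpace H]
    (P : Set (H × ℝ)) (hne : ∃ g : H, ∀ p ∈ P, ⟪p.1, g⟫ ≤ p.2) :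
    ∃ g : H, (∀ p ∈ P, ⟪p.1, g⟫ ≤ p.2) ∧
      ∀ h : H, (∀ p ∈ P, ⟪p.1, h⟫ ≤ p.2) → ‖h‖ = ‖g‖ → h = g := by
  let K : Set H := {g | ∀ p ∈ P, ⟪p.1, g⟫ ≤ p.2}
  have hKc : IsClosed K := by
    have : K = ⋂ p ∈ P, {x : H | ⟪p.1, x⟫ ≤ p.2} := by ext; simp [K]
    rw [this]
    exact isClosed_biInter fun p _ => isClosed_le (by fun_prop) continuous_const
  have hKconv : Convex ℝ K := by
    intro x hx y hy a b ha hb hab p hp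
    have h1 := hx p hp
    have h2 := hy p hp
    rw [inner_add_right, inner_smul_right, inner_smul_right]
    calc a * ⟪p.1, x⟫ + b * ⟪p.1, y⟫ ≤ a * p.2 + b * p.2 := by gcongr
      _ = p.2 := by rw [← add_mul, hab, one_mul]
  obtain ⟨g, hg, hmin⟩ := exists_norm_eq_iInf_of_complete_convex (K := K) hne hKc.isComplete
    hKconv (0 : H)
  refine ⟨g, hg, fun h hh hn => ?_⟩
  have h1 := (norm_eq_iInf_iff_real_inner_le_zero hKconv hg).1 hmin h hh
  rw [zero_sub, inner_neg_left, inner_sub_right, real_inner_self_eq_norm_sq] at h1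
  have h2 := norm_sub_sq_real h g
  rw [real_inner_comm] at h2
  rw [hn] at h2
  have h3 : ‖h - g‖ ^ 2 ≤ 0 := by rw [h2]; linarith
  have h4 : ‖h - g‖ = 0 := by
    have := sq_nonneg ‖h - g‖
    exact pow_eq_zero_iff (two_ne_zero) |>.1 (le_antisymm h3 this)
  exact sub_eq_zero.1 (norm_eq_zero.1 h4)

/-- Half-spaces cutting out `0 ≤ g ≤ 1`, `c ≤ ∫ g` in `L²`. -/
def auxP {X : Type*} [MeasurableSpace X] (m : Measure X) [IsProbabilityMeasure m] (c : ℝ) :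
    Set (Lp ℝ 2 m × ℝ) :=
  {p | (∃ b : Lp ℝ 2 m, 0 ≤ᵐ[m] b ∧ p = (-b, 0)) ∨
    (∃ b : Lp ℝ 2 m, 0 ≤ᵐ[m] b ∧ p = (b, ∫ x, b x ∂m)) ∨
    p = (-(indicatorConstLp 2 MeasurableSet.univ (measure_ne_top m _) (1 : ℝ)), -c)}

lemma aux_int {X : Type*} [MeasurableSpace X] (m : Measure X) [IsProbabilityMeasure m]
    (g : Lp ℝ 2 m) : Integrable g m :=
  (Lp.memLp g).integrable (by norm_num)

lemma aux_inner {X : Type*} [MeasurableSpace X] (m : Measure X) [IsProbabilityMeasure m]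
    (b g : Lp ℝ 2 m) : ⟪b, g⟫ = ∫ x, b x * g x ∂m := by
  rw [L2.inner_def]
  congr 1
  ext x
  simp [mul_comm]

lemma aux_inner_int {X : Type*} [MeasurableSpace X] (m : Measure X) [IsProbabilityMeasure m]
    (b g : Lp ℝ 2 m) : Integrable (fun x => b x * g x) m := by
  have := L2.integrable_inner (𝕜 := ℝ) b g
  refine this.congr (Filter.Eventually.of_forall fun x => ?_)
  simp [mul_comm]

lemma auxP_iff {X : Type*} [MeasurableSpace X] (m : Measure X) [IsProbabilityMeasure m] (c : ℝ)
    (g : Lp ℝ 2 m) : (∀ p ∈ auxP m c, ⟪p.1, g⟫ ≤ p.2) ↔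
      (0 ≤ᵐ[m] g ∧ (∀ᵐ x ∂m, g x ≤ 1) ∧ c ≤ ∫ x, g x ∂m) := by
  constructor
  · intro h
    have hind : ∀ (s : Set X) (hs : MeasurableSet s),
        0 ≤ᵐ[m] (indicatorConstLp 2 (μ := m) (s := s) hs (measure_ne_top m s) (1 : ℝ)) := by
      intro s hs
      filter_upwards [indicatorConstLp_coeFn (p := 2) (hs := hs) (hμs := measure_ne_top m s)
        (c := (1 : ℝ))] with x hx
      rw [hx]
      exact Set.indicator_nonneg (fun _ _ => zero_le_one) x
    refine ⟨?_, ?_, ?_⟩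
    · refine ae_nonneg_of_forall_setIntegral_nonneg (aux_int m g) fun s hs _ => ?_
      have := h _ (Or.inl ⟨_, hind s hs, rfl⟩)
      simp only [inner_neg_left] at this
      rw [L2.inner_indicatorConstLp_one] at this
      linarith
    · refine ae_le_of_forall_setIntegral_le (aux_int m g) (integrable_const 1) fun s hs _ => ?_
      have := h _ (Or.inr (Or.inl ⟨_, hind s hs, rfl⟩))
      simp only at this
      rw [L2.inner_indicatorConstLp_one, integral_indicatorConstLp] at this
      simpa using this
    · have := h _ (Or.inr (Or.inr rfl))
      simp only [inner_neg_left] at this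
      rw [L2.inner_indicatorConstLp_one, setIntegral_univ] at this
      linarith
  · rintro ⟨h0, h1, hc⟩ p (⟨b, hb, rfl⟩ | ⟨b, hb, rfl⟩ | rfl)
    · simp only [inner_neg_left]
      rw [aux_inner, neg_nonpos]
      apply integral_nonneg_of_ae
      filter_upwards [h0, hb] with x hx hy
      exact mul_nonneg hy hx
    · simp only
      rw [aux_inner]
      apply integral_mono_ae (aux_inner_int m b g) (aux_int m b)
      filter_upwards [h1, hb] with x hx hy
      exact mul_le_of_le_one_right hy hx
    · simp only [inner_neg_left]
      rw [L2.inner_indicatorConstLp_one, setIntegral_univ]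
      linarith

lemma aux_norm {X : Type*} [MeasurableSpace X] (m : Measure X) [IsProbabilityMeasure m]
    (g : Lp ℝ 2 m) (h0 : 0 ≤ᵐ[m] g) (h1 : ∀ᵐ x ∂m, g x ≤ 1) : ‖g‖ ≤ 1 := by
  have := Lp.norm_le_of_ae_bound (p := 2) (f := g) (C := 1) zero_le_one (by
    filter_upwards [h0, h1] with x hx hy
    rw [Real.norm_of_nonneg hx]; exact hy)
  simpa [measureUnivNNReal] using this

lemma aux_exists {X : Type*} [MeasurableSpace X] (m : Measure X) [IsProbabilityMeasure m]
    (ε M : ℝ) (hε : 0 < ε) (hM : 0 ≤ M)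
    (A : Set (X → ℝ))
    (hA_meas : ∀ φ ∈ A, Measurable φ)
    (hA_conv : ∀ φ ∈ A, ∀ ψ ∈ A, ∀ t : ℝ, 0 ≤ t → t ≤ 1 →
      (fun x => t * φ x + (1 - t) * ψ x) ∈ A)
    (hA : ∀ φ ∈ A, m {x | M < |φ x|} ≤ ENNReal.ofReal (ε / 2)) :
    ∃ g : Lp ℝ 2 m, (∀ p ∈ auxP m (1 - ε / 2), ⟪p.1, g⟫ ≤ p.2) ∧
      ∀ b ∈ {b : Lp ℝ 2 m | ∃ φ ∈ A, b ≤ᵐ[m] φ}, ⟪b, g⟫ ≤ M := by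
  have key : ∀ b ∈ {b : Lp ℝ 2 m | ∃ φ ∈ A, b ≤ᵐ[m] φ}, ∃ g : Lp ℝ 2 m,
      (∀ p ∈ auxP m (1 - ε / 2), ⟪p.1, g⟫ ≤ p.2) ∧ ⟪b, g⟫ ≤ M := by
    rintro b ⟨φ, hφ, hb⟩
    have hs : MeasurableSet {x | M < |φ x|} := measurableSet_lt measurable_const (hA_meas φ hφ).abs
    have hs' := hs.compl
    have hmr : m.real {x | M < |φ x|} ≤ ε / 2 :=
      ENNReal.toReal_le_of_le_ofReal (by positivity) (hA φ hφ)
    have hmr' : m.real {x | M < |φ x|}ᶜ = 1 - m.real {x | M < |φ x|} := probReal_compl_eq_one_sub hs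
    refine ⟨indicatorConstLp 2 hs' (measure_ne_top m _) (1 : ℝ), ?_, ?_⟩
    · rw [auxP_iff]
      have hco := indicatorConstLp_coeFn (p := 2) (hs := hs') (hμs := measure_ne_top m _)
        (c := (1 : ℝ))
      refine ⟨?_, ?_, ?_⟩
      · filter_upwards [hco] with x hx
        rw [hx]
        exact Set.indicator_nonneg (fun _ _ => zero_le_one) x
      · filter_upwards [hco] with x hx
        rw [hx]
        exact Set.indicator_le_self' (fun _ _ => zero_le_one) x
      · rw [integral_indicatorConstLp]
        simp only [smul_eq_mul, mul_one]
        linarith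
    · rw [real_inner_comm, L2.inner_indicatorConstLp_one]
      calc ∫ x in {x | M < |φ x|}ᶜ, b x ∂m ≤ ∫ x in {x | M < |φ x|}ᶜ, M ∂m := by
            apply setIntegral_mono_on_ae (aux_int m b).integrableOn (integrable_const M) hs'
            filter_upwards [hb] with x hx hxs
            simp only [Set.mem_compl_iff, Set.mem_ofPred_eq, not_lt] at hxs
            exact hx.trans ((le_abs_self _).trans hxs)
        _ = m.real {x | M < |φ x|}ᶜ * M := by simp
        _ ≤ 1 * M := by gcongr; exact measureReal_le_one
        _ = M := one_mul M
  refine aux_minimax (auxP m (1 - ε / 2)) 1 ?_ ?_ _ ?_ M key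
  · intro g hg
    rw [auxP_iff] at hg
    exact aux_norm m g hg.1 hg.2.1
  · refine ⟨indicatorConstLp 2 MeasurableSet.univ (measure_ne_top m _) (1 : ℝ), ?_⟩
    rw [auxP_iff]
    have hco := indicatorConstLp_coeFn (p := 2) (hs := MeasurableSet.univ)
      (hμs := measure_ne_top m _) (c := (1 : ℝ))
    refine ⟨?_, ?_, ?_⟩
    · filter_upwards [hco] with x hx
      rw [hx]
      exact Set.indicator_nonneg (fun _ _ => zero_le_one) x
    · filter_upwards [hco] with x hx
      rw [hx]
      exact Set.indicator_le_self' (fun _ _ => zero_le_one) x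
    · rw [integral_indicatorConstLp]
      simp
      linarith
  · rintro b ⟨φ, hφ, hb⟩ b' ⟨ψ, hψ, hb'⟩ s t hs ht hst
    refine ⟨_, hA_conv φ hφ ψ hψ s hs (by linarith), ?_⟩
    filter_upwards [hb, hb', Lp.coeFn_add (s • b) (t • b'), Lp.coeFn_smul s b,
      Lp.coeFn_smul t b'] with x h1 h2 h3 h4 h5
    rw [h3, Pi.add_apply, h4, h5]
    have : t = 1 - s := by linarith
    subst this
    simp only [Pi.smul_apply, smul_eq_mul]
    gcongr

lemma aux_rearr {X : Type*} [MeasurableSpace X] (m : Measure X) [IsProbabilityMeasure m]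
    (δ M : ℝ) (hδ : 0 < δ) (φ : X → ℝ) (hφ : Measurable φ) (h : rearr m φ δ ≤ M) :
    m {x | M < |φ x|} ≤ ENNReal.ofReal δ := by
  have hmeas : ∀ l : ℝ, MeasurableSet {x | l < |φ x|} := fun l =>
    measurableSet_lt measurable_const hφ.abs
  have hne : {l : ℝ | 0 < l ∧ m {x | l < |φ x|} ≤ ENNReal.ofReal δ}.Nonempty := by
    have ht := tendsto_measure_iInter_atTop (μ := m) (s := fun n : ℕ => {x | (n : ℝ) < |φ x|})
      (fun n => (hmeas n).nullMeasurableSet)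
      (fun i j hij x (hx : (j : ℝ) < |φ x|) =>
        show (i : ℝ) < |φ x| from lt_of_le_of_lt (Nat.cast_le.2 hij) hx) ⟨0, measure_ne_top m _⟩
    have he : ⋂ n : ℕ, {x | (n : ℝ) < |φ x|} = ∅ := by
      rw [Set.eq_empty_iff_forall_notMem]
      intro x hx
      obtain ⟨n, hn⟩ := exists_nat_gt |φ x|
      have := Set.mem_iInter.1 hx n
      exact absurd this (not_lt.2 hn.le)
    rw [he, measure_empty] at ht
    have h1 := (ht.eventually (gt_mem_nhds (ENNReal.ofReal_pos.2 hδ))).and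
      (Filter.eventually_gt_atTop 0)
    obtain ⟨n, hn, hn0⟩ := h1.exists
    exact ⟨n, by exact_mod_cast hn0, hn.le⟩
  have hlt : ∀ l, M < l → m {x | l < |φ x|} ≤ ENNReal.ofReal δ := by
    intro l hl
    obtain ⟨l', ⟨_, h2⟩, h3⟩ := exists_lt_of_csInf_lt hne (lt_of_le_of_lt h hl)
    exact (measure_mono fun x hx => lt_trans h3 hx).trans h2
  have hU : {x | M < |φ x|} = ⋃ n : ℕ, {x | M + 1 / ((n : ℝ) + 1) < |φ x|} := by
    ext x
    simp only [Set.mem_iUnion, Set.mem_ofPred_eq]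
    constructor
    · intro hx
      obtain ⟨n, hn⟩ := exists_nat_one_div_lt (sub_pos.2 hx)
      exact ⟨n, by linarith⟩
    · rintro ⟨n, hn⟩
      have : (0 : ℝ) < 1 / ((n : ℝ) + 1) := by positivity
      linarith
  rw [hU, Monotone.measure_iUnion]
  · refine iSup_le fun n => hlt _ ?_
    have : (0 : ℝ) < 1 / ((n : ℝ) + 1) := by positivity
    linarith
  · intro i j hij x hx
    have : 1 / ((j : ℝ) + 1) ≤ 1 / ((i : ℝ) + 1) := Nat.one_div_le_one_div hij
    simp only [Set.mem_ofPred_eq] at hx ⊢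
    exact lt_of_le_of_lt (by linarith) hx

lemma aux_final {X : Type*} [MeasurableSpace X] (m : Measure X) [IsProbabilityMeasure m]
    (M : ℝ) (hM : 0 ≤ M) (g : Lp ℝ 2 m) (h0 : 0 ≤ᵐ[m] g)
    (φ : X → ℝ) (hφ : Measurable φ) (hφ0 : ∀ᵐ x ∂m, 0 ≤ φ x)
    (h : ∀ b : Lp ℝ 2 m, b ≤ᵐ[m] φ → ⟪b, g⟫ ≤ M) :
    ∫⁻ x in {x | 1 / 2 ≤ g x}, ENNReal.ofReal (φ x) ∂m ≤ 2 * ENNReal.ofReal M := by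
  have hS : MeasurableSet {x | 1 / 2 ≤ g x} :=
    measurableSet_le measurable_const (Lp.stronglyMeasurable g).measurable
  have hsup : ∀ x, ENNReal.ofReal (φ x) = ⨆ n : ℕ, ENNReal.ofReal (max 0 (min (φ x) n)) := by
    intro x
    apply le_antisymm
    · obtain ⟨n, hn⟩ := exists_nat_ge (φ x)
      refine le_iSup_of_le n (ENNReal.ofReal_le_ofReal ?_)
      rw [min_eq_left hn]
      exact le_max_right _ _
    · refine iSup_le fun n => ?_
      rw [ENNReal.ofReal_max, ENNReal.ofReal_zero]
      exact max_le zero_le (ENNReal.ofReal_le_ofReal (min_le_left _ _))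
  simp_rw [hsup]
  have hm : ∀ n : ℕ, Measurable fun x => max 0 (min (φ x) n) := fun n => by fun_prop
  rw [lintegral_iSup (fun n => (hm n).ennreal_ofReal)]
  · refine iSup_le fun n => ?_
    have hL : MemLp (fun x => max 0 (min (φ x) n)) 2 m := by
      refine MemLp.of_bound (hm n).aestronglyMeasurable n (Filter.Eventually.of_forall fun x => ?_)
      rw [Real.norm_of_nonneg (le_max_left _ _)]
      exact max_le (Nat.cast_nonneg n) (min_le_right _ _)
    have hco := hL.coeFn_toLp
    have hb := h (hL.toLp _) (by
      filter_upwards [hco, hφ0] with x hx h0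
      rw [hx]
      exact max_le h0 (min_le_left _ _))
    have h2 : (2 : ENNReal) * ENNReal.ofReal M = ENNReal.ofReal (2 * M) := by
      rw [ENNReal.ofReal_mul zero_le_two]; simp
    rw [h2]
    calc ∫⁻ x in {x | 1 / 2 ≤ g x}, ENNReal.ofReal (max 0 (min (φ x) n)) ∂m
        ≤ ∫⁻ x in {x | 1 / 2 ≤ g x}, ENNReal.ofReal (2 * (hL.toLp _ x * g x)) ∂m := by
          apply setLIntegral_mono_ae' hS
          filter_upwards [hco] with x hx hxs
          rw [hx]
          apply ENNReal.ofReal_le_ofReal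
          have h3 : (0 : ℝ) ≤ max 0 (min (φ x) n) := le_max_left _ _
          change 1 / 2 ≤ g x at hxs
          nlinarith
      _ ≤ ∫⁻ x, ENNReal.ofReal (2 * (hL.toLp _ x * g x)) ∂m := setLIntegral_le_lintegral _ _
      _ = ENNReal.ofReal (∫ x, 2 * (hL.toLp _ x * g x) ∂m) := by
          rw [ofReal_integral_eq_lintegral_ofReal ((aux_inner_int m _ g).const_mul 2)]
          filter_upwards [hco, h0] with x hx hg
          rw [hx]
          have h3 : (0 : ℝ) ≤ max 0 (min (φ x) n) := le_max_left _ _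
          exact mul_nonneg zero_le_two (mul_nonneg h3 hg)
      _ ≤ ENNReal.ofReal (2 * M) := by
          rw [integral_const_mul, ← aux_inner]
          exact ENNReal.ofReal_le_ofReal (by linarith)
  · intro i j hij x
    apply ENNReal.ofReal_le_ofReal
    have : (i : ℝ) ≤ j := Nat.cast_le.2 hij
    exact max_le_max le_rfl (min_le_min le_rfl this)

end helpers


/-- Let a countable group `Γ` act on a probability space `(X,m)` by
measure-preserving measurable bijections, and let `A` be a convex, globally `Γ`-invariant set
of a.e. nonnegative functions in `L⁰(X,m)`.  Then for every `ε > 0` there is a `Γ`-invariant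
measurable set `S(ε) ⊆ X` with `m(X \ S(ε)) ≤ ε` and
`sup_{φ∈A} ∫_{S(ε)} φ dm ≤ 2 sup_{φ∈A} φ⋆(ε/2)`. -/
theorem stmt9 {Γ X : Type*} [Group Γ] [Countable Γ] [MeasurableSpace X]
    (m : Measure X) [IsProbabilityMeasure m]
    (β : Γ → X → X)
    (hβ_meas : ∀ s, Measurable (β s))
    (hβ_one : ∀ x, β 1 x = x)
    (hβ_mul : ∀ s t x, β (s * t) x = β s (β t x))
    (hβ_mp : ∀ s, MeasurePreserving (β s) m m)
    (A : Set (X → ℝ))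
    (hA_meas : ∀ φ ∈ A, Measurable φ)
    (hA_nonneg : ∀ φ ∈ A, ∀ᵐ x ∂m, 0 ≤ φ x)
    (hA_conv : ∀ φ ∈ A, ∀ ψ ∈ A, ∀ t : ℝ, 0 ≤ t → t ≤ 1 →
      (fun x => t * φ x + (1 - t) * ψ x) ∈ A)
    (hA_inv : ∀ φ ∈ A, ∀ s : Γ, (fun x => φ (β s⁻¹ x)) ∈ A) :
    ∀ ε : ℝ, 0 < ε → ∃ S : Set X, MeasurableSet S ∧
      (∀ s : Γ, m (symmDiff (β s ⁻¹' S) S) = 0) ∧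
      m Sᶜ ≤ ENNReal.ofReal ε ∧
      (⨆ φ ∈ A, ∫⁻ x in S, ENNReal.ofReal (φ x) ∂m) ≤
        2 * ⨆ φ ∈ A, ENNReal.ofReal (rearr m φ (ε / 2)) := by
  intro ε hε
  set Q : ENNReal := ⨆ φ ∈ A, ENNReal.ofReal (rearr m φ (ε / 2)) with hQ
  by_cases hQtop : Q = ⊤
  · refine ⟨Set.univ, MeasurableSet.univ, ?_, ?_, ?_⟩
    · intro s; simp
    · simp
    · rw [hQtop]; simp
  set M : ℝ := Q.toReal with hMdef
  have hM : 0 ≤ M := ENNReal.toReal_nonneg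
  have hMQ : ENNReal.ofReal M = Q := ENNReal.ofReal_toReal hQtop
  have hA : ∀ φ ∈ A, m {x | M < |φ x|} ≤ ENNReal.ofReal (ε / 2) := by
    intro φ hφ
    refine aux_rearr m (ε / 2) M (by positivity) φ (hA_meas φ hφ) ?_
    have h1 : ENNReal.ofReal (rearr m φ (ε / 2)) ≤ Q :=
      le_iSup₂ (f := fun φ (_ : φ ∈ A) => ENNReal.ofReal (rearr m φ (ε / 2))) φ hφ
    rw [← hMQ] at h1
    exact (ENNReal.ofReal_le_ofReal_iff hM).1 h1
  let Y : Set (Lp ℝ 2 m) := {b : Lp ℝ 2 m | ∃ φ ∈ A, b ≤ᵐ[m] φ}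
  let P : Set (Lp ℝ 2 m × ℝ) := auxP m (1 - ε / 2) ∪ Set.image (fun b => (b, M)) Y
  have hP : ∀ g : Lp ℝ 2 m, (∀ p ∈ P, inner ℝ p.1 g ≤ p.2) ↔
      ((0 ≤ᵐ[m] g ∧ (∀ᵐ x ∂m, g x ≤ 1) ∧ 1 - ε / 2 ≤ ∫ x, g x ∂m) ∧
        ∀ b ∈ Y, inner ℝ b g ≤ M) := by
    intro g
    rw [← auxP_iff]
    constructor
    · intro h
      exact ⟨fun p hp => h p (Or.inl hp), fun b hb => h (b, M) (Or.inr ⟨b, hb, rfl⟩)⟩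
    · rintro ⟨h1, h2⟩ p (hp | ⟨b, hb, rfl⟩)
      · exact h1 p hp
      · exact h2 b hb
  obtain ⟨g, hg, hmin⟩ := aux_minnorm P (by
    obtain ⟨g, hg1, hg2⟩ := aux_exists m ε M hε hM A hA_meas hA_conv hA
    rw [auxP_iff] at hg1
    exact ⟨g, (hP g).2 ⟨hg1, hg2⟩⟩)
  obtain ⟨⟨h0, h1, hmass⟩, hY⟩ := (hP g).1 hg
  have hinv : ∀ s : Γ, (fun x => g (β s x)) =ᵐ[m] g := by
    intro s
    have hU := fun (t : Γ) (f : Lp ℝ 2 m) => Lp.coeFn_compMeasurePreserving f (hβ_mp t)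
    have hgeq : Lp.compMeasurePreserving (β s) (hβ_mp s) g = g := by
      refine hmin _ ((hP _).2 ⟨⟨?_, ?_, ?_⟩, ?_⟩) (Lp.norm_compMeasurePreserving g (hβ_mp s))
      · filter_upwards [hU s g, (hβ_mp s).quasiMeasurePreserving.ae h0] with x hx h
        rw [hx]; exact h
      · filter_upwards [hU s g, (hβ_mp s).quasiMeasurePreserving.ae h1] with x hx h
        rw [hx]; exact h
      · rw [integral_congr_ae (hU s g)]
        have h2 := integral_map (μ := m) (hβ_mp s).measurable.aemeasurable (f := g)
          (by rw [(hβ_mp s).map_eq]; exact Lp.aestronglyMeasurable g)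
        rw [(hβ_mp s).map_eq] at h2
        rw [h2] at hmass
        exact hmass
      · rintro b ⟨φ, hφ, hb⟩
        have hb2 := hY (Lp.compMeasurePreserving (β s⁻¹) (hβ_mp s⁻¹) b)
          ⟨_, hA_inv φ hφ s, by
            filter_upwards [hU s⁻¹ b, (hβ_mp s⁻¹).quasiMeasurePreserving.ae hb] with x hx h
            rw [hx]; exact h⟩
        have hbb : Lp.compMeasurePreserving (β s) (hβ_mp s)
            (Lp.compMeasurePreserving (β s⁻¹) (hβ_mp s⁻¹) b) = b := by
          apply Lp.ext
          filter_upwards [hU s (Lp.compMeasurePreserving (β s⁻¹) (hβ_mp s⁻¹) b),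
            (hβ_mp s).quasiMeasurePreserving.ae (hU s⁻¹ b)] with x hx hx2
          rw [hx, Function.comp_apply, hx2, Function.comp_apply, ← hβ_mul, inv_mul_cancel, hβ_one]
        rw [← (Lp.compMeasurePreservingₗᵢ ℝ (β s) (hβ_mp s)).inner_map_map] at hb2
        rw [← hbb]
        exact hb2
    have := hU s g
    rw [hgeq] at this
    exact this.symm
  refine ⟨{x | 1 / 2 ≤ g x},
    measurableSet_le measurable_const (Lp.stronglyMeasurable g).measurable, ?_, ?_, ?_⟩
  · intro s
    rw [measure_symmDiff_eq_zero_iff]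
    filter_upwards [hinv s] with x hx
    change (1 / 2 ≤ g (β s x)) = (1 / 2 ≤ g x)
    rw [hx]
  · have hgi := aux_int m g
    have h3 := mul_meas_ge_le_integral_of_nonneg (μ := m) (f := fun x => 1 - g x)
      (by filter_upwards [h1] with x hx; exact sub_nonneg.2 hx)
      ((integrable_const 1).sub hgi) (1 / 2)
    rw [integral_sub (integrable_const 1) hgi] at h3
    simp only [integral_const, probReal_univ, smul_eq_mul, mul_one] at h3
    have h4 : m.real {x | 1 / 2 ≤ g x}ᶜ ≤ m.real {x | 1 / 2 ≤ 1 - g x} := by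
      refine measureReal_mono (fun x hx => ?_) (measure_ne_top m _)
      simp only [Set.mem_compl_iff, Set.mem_ofPred_eq, not_le] at hx ⊢
      linarith
    rw [← ENNReal.ofReal_toReal (measure_ne_top m {x | 1 / 2 ≤ g x}ᶜ)]
    apply ENNReal.ofReal_le_ofReal
    change m.real {x | 1 / 2 ≤ g x}ᶜ ≤ ε
    linarith
  · refine iSup₂_le fun φ hφ => ?_
    rw [← hMQ]
    exact aux_final m M hM g h0 φ (hA_meas φ hφ) (hA_nonneg φ hφ)
      (fun b hb => hY b ⟨φ, hφ, hb⟩)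
end

section
/- Let H be a separable real Hilbert space, (X,m) a probability space, and T : H → L⁰(X,m) a linear map that is continuous in measure. Then there exists a function C : (0,∞) → [0,1] with lim_{λ→∞} C(λ) = 0 such that for every finite family ξ₁,…,ξₙ ∈ H with Σ_{j=1}^n ‖ξⱼ‖² ≤ 1, one has m({x ∈ X : (Σ_{j=1}^n (Tξⱼ)(x)²)^{1/2} ≥ λ}) ≤ C(λ) for all λ > 0. -/
open MeasureTheory Filter

noncomputable def sg11 (b : Bool) : ℝ := if b then 1 else -1

lemma sum_cons11 {n : ℕ} (f : (Fin (n+1) → Bool) → ℝ) :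
    ∑ e, f e = ∑ e : Fin n → Bool, (f (Fin.cons true e) + f (Fin.cons false e)) := by
  rw [← (Fin.consEquiv (fun _ : Fin (n+1) => Bool)).sum_comp, Fintype.sum_prod_type]
  simp [Fin.consEquiv, Finset.sum_add_distrib]

lemma second11 {H : Type*} [NormedAddCommGroup H] [InnerProductSpace ℝ H] :
    ∀ (n : ℕ) (ξ : Fin n → H),
    ∑ e : Fin n → Bool, ‖∑ j, sg11 (e j) • ξ j‖ ^ 2 = 2 ^ n * ∑ j, ‖ξ j‖ ^ 2 := by
  intro n
  induction n with
  | zero => intro ξ; simp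
  | succ n ih =>
    intro ξ
    rw [sum_cons11]
    have h : ∀ e : Fin n → Bool, ‖∑ j, sg11 ((Fin.cons true e : Fin (n+1) → Bool) j) • ξ j‖ ^ 2
        + ‖∑ j, sg11 ((Fin.cons false e : Fin (n+1) → Bool) j) • ξ j‖ ^ 2
        = 2 * ‖ξ 0‖ ^ 2 + 2 * ‖∑ j, sg11 (e j) • ξ j.succ‖ ^ 2 := by
      intro e
      simp only [Fin.sum_univ_succ, Fin.cons_zero, Fin.cons_succ]
      have := parallelogram_law_with_norm ℝ (∑ j, sg11 (e j) • ξ j.succ) (ξ 0)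
      simp only [sg11, if_true, one_smul, neg_smul, Bool.false_eq_true, if_false] at this ⊢
      rw [add_comm (ξ 0), add_comm (-ξ 0), ← sub_eq_add_neg]
      nlinarith
    rw [Finset.sum_congr rfl (fun e _ => h e), Finset.sum_add_distrib, ← Finset.mul_sum,
      ← Finset.mul_sum, ih (fun j => ξ j.succ), Fin.sum_univ_succ]
    simp
    ring

lemma second11' (n : ℕ) (a : Fin n → ℝ) :
    ∑ e : Fin n → Bool, (∑ j, sg11 (e j) * a j) ^ 2 = 2 ^ n * ∑ j, a j ^ 2 := by
  simpa using second11 n a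

lemma fourth11 : ∀ (n : ℕ) (a : Fin n → ℝ),
    ∑ e : Fin n → Bool, (∑ j, sg11 (e j) * a j) ^ 4 ≤ 2 ^ n * (3 * (∑ j, a j ^ 2) ^ 2) := by
  intro n
  induction n with
  | zero => intro a; simp
  | succ n ih =>
    intro a
    rw [sum_cons11]
    have h : ∀ e : Fin n → Bool, (∑ j, sg11 ((Fin.cons true e : Fin (n+1) → Bool) j) * a j) ^ 4
        + (∑ j, sg11 ((Fin.cons false e : Fin (n+1) → Bool) j) * a j) ^ 4
        = 2 * a 0 ^ 4 + 12 * a 0 ^ 2 * (∑ j, sg11 (e j) * a j.succ) ^ 2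
          + 2 * (∑ j, sg11 (e j) * a j.succ) ^ 4 := by
      intro e
      simp only [Fin.sum_univ_succ, Fin.cons_zero, Fin.cons_succ]
      simp only [sg11, if_true, Bool.false_eq_true, if_false]
      ring
    rw [Finset.sum_congr rfl (fun e _ => h e), Finset.sum_add_distrib, Finset.sum_add_distrib,
      ← Finset.mul_sum, ← Finset.mul_sum, second11' n (fun j => a j.succ), Fin.sum_univ_succ]
    have := ih (fun j => a j.succ)
    simp only [Finset.sum_const, Finset.card_univ, Fintype.card_fun, Fintype.card_bool,
      Fintype.card_fin, nsmul_eq_mul]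
    push_cast
    have h2 : (0:ℝ) ≤ 2 ^ n * a 0 ^ 4 := by positivity
    rw [pow_succ (2 : ℝ) n, ← Finset.mul_sum]
    nlinarith

/-- Paley-Zygmund type counting inequality. -/
lemma pz11 (n : ℕ) (a : Fin n → ℝ) (l : ℝ) (hl : 0 < l) (h : l ≤ Real.sqrt (∑ j, a j ^ 2)) :
    (11 / 100 : ℝ) * 2 ^ n ≤
      ∑ e : Fin n → Bool, if l / 2 ≤ |∑ j, sg11 (e j) * a j| then (1 : ℝ) else 0 := by
  set s := ∑ j, a j ^ 2 with hs
  have hls : l ^ 2 ≤ s := (Real.le_sqrt' hl).1 h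
  have hs0 : 0 < s := lt_of_lt_of_le (by positivity) hls
  have key : ∀ S : ℝ, (1 / 25) * (11 * (S ^ 2 / s) - S ^ 4 / s ^ 2 - 21 / 4)
      ≤ if l / 2 ≤ |S| then (1 : ℝ) else 0 := by
    intro S
    have e : S ^ 4 / s ^ 2 = (S ^ 2 / s) ^ 2 := by rw [div_pow]; ring
    rw [e]
    split_ifs with hc
    · nlinarith [sq_nonneg (S ^ 2 / s - 11 / 2)]
    · push Not at hc
      have h1 : S ^ 2 < (l / 2) ^ 2 := by
        rw [← sq_abs S]; exact pow_lt_pow_left₀ hc (abs_nonneg _) (by norm_num)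
      have h2 : S ^ 2 / s ≤ 1 / 2 := by rw [div_le_iff₀ hs0]; nlinarith
      nlinarith
  refine le_trans ?_ (Finset.sum_le_sum (fun e _ => key _))
  rw [← Finset.mul_sum, Finset.sum_sub_distrib, Finset.sum_sub_distrib, ← Finset.mul_sum,
    ← Finset.sum_div, ← Finset.sum_div, second11', ← hs, mul_div_cancel_right₀ _ hs0.ne']
  have h4 : (∑ e : Fin n → Bool, (∑ j, sg11 (e j) * a j) ^ 4) / s ^ 2 ≤ 2 ^ n * 3 := by
    rw [div_le_iff₀ (by positivity)]
    have := fourth11 n a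
    rw [← hs] at this
    linarith
  simp only [Finset.sum_const, Finset.card_univ, Fintype.card_fun, Fintype.card_bool,
      Fintype.card_fin, nsmul_eq_mul]
  push_cast
  linarith

lemma unif11 {H X : Type*} [NormedAddCommGroup H] [InnerProductSpace ℝ H] [MeasurableSpace X]
    (m : Measure X) [IsProbabilityMeasure m]
    (T : H → X → ℝ)
    (hT_smul : ∀ (r : ℝ) (ξ : H), T (r • ξ) =ᵐ[m] fun x => r * T ξ x)
    (hT_cont : ∀ (ξs : ℕ → H) (ξ : H), Tendsto ξs atTop (nhds ξ) →
      TendstoInMeasure m (fun n => T (ξs n)) atTop (T ξ)) (R δ : ℝ) (hδ : 0 < δ) :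
    ∃ M : ℝ, ∀ ξ, ‖ξ‖ ≤ R → m.real {x | M ≤ |T ξ x|} ≤ δ := by
  by_contra hcon
  push Not at hcon
  choose ξ hξ hm using fun k : ℕ => hcon (k + 1)
  have hlim : Tendsto (fun k : ℕ => ((k : ℝ) + 1)⁻¹ • ξ k) atTop (nhds 0) := by
    refine squeeze_zero_norm (a := fun k : ℕ => ((k : ℝ) + 1)⁻¹ * R) ?_ ?_
    · intro k
      rw [norm_smul, Real.norm_of_nonneg (by positivity)]
      exact mul_le_mul_of_nonneg_left (hξ k) (by positivity)
    · have := (tendsto_one_div_add_atTop_nhds_zero_nat (𝕜 := ℝ)).mul_const R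
      simpa using this
  have h0 : T 0 =ᵐ[m] fun _ => 0 := by simpa using hT_smul 0 0
  have ht := (tendstoInMeasure_iff_measureReal_norm.1 (hT_cont _ _ hlim)) 1 one_pos
  obtain ⟨k, hk⟩ := (ht.eventually (gt_mem_nhds hδ)).exists
  refine absurd hk (not_lt.2 ((hm k).le.trans ?_))
  refine ENNReal.toReal_mono (measure_ne_top _ _) (measure_mono_ae ?_)
  filter_upwards [h0, hT_smul ((k : ℝ) + 1)⁻¹ (ξ k)] with x hx0 hx hxm
  have hxm' : (k : ℝ) + 1 ≤ |T (ξ k) x| := hxm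
  change 1 ≤ ‖T (((k : ℝ) + 1)⁻¹ • ξ k) x - T 0 x‖
  rw [hx, hx0, sub_zero, norm_mul, Real.norm_of_nonneg (by positivity), Real.norm_eq_abs,
    inv_mul_eq_div, le_div_iff₀ (by positivity)]
  linarith

lemma lin11 {H X : Type*} [NormedAddCommGroup H] [InnerProductSpace ℝ H] [MeasurableSpace X]
    (m : Measure X) (T : H → X → ℝ)
    (hT_add : ∀ ξ η, T (ξ + η) =ᵐ[m] fun x => T ξ x + T η x)
    (hT_smul : ∀ (r : ℝ) (ξ : H), T (r • ξ) =ᵐ[m] fun x => r * T ξ x) :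
    ∀ (n : ℕ) (ξ : Fin n → H) (c : Fin n → ℝ),
    T (∑ j, c j • ξ j) =ᵐ[m] fun x => ∑ j, c j * T (ξ j) x := by
  intro n
  induction n with
  | zero => intro ξ c; simpa using hT_smul 0 0
  | succ n ih =>
    intro ξ c
    simp only [Fin.sum_univ_succ]
    filter_upwards [hT_add (c 0 • ξ 0) (∑ j : Fin n, c j.succ • ξ j.succ), hT_smul (c 0) (ξ 0),
      ih (fun j => ξ j.succ) (fun j => c j.succ)] with x h1 h2 h3
    rw [h1, h2, h3]

lemma main11 {H X : Type*} [NormedAddCommGroup H] [InnerProductSpace ℝ H] [MeasurableSpace X]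
    (m : Measure X) [IsProbabilityMeasure m]
    (T : H → X → ℝ)
    (hT_meas : ∀ ξ, Measurable (T ξ))
    (hT_add : ∀ ξ η, T (ξ + η) =ᵐ[m] fun x => T ξ x + T η x)
    (hT_smul : ∀ (r : ℝ) (ξ : H), T (r • ξ) =ᵐ[m] fun x => r * T ξ x)
    (l R δ : ℝ) (hl : 0 < l) (hR : 0 < R) (hδ : 0 ≤ δ)
    (hM : ∀ ξ, ‖ξ‖ ≤ R → m.real {x | l / 2 ≤ |T ξ x|} ≤ δ)
    (n : ℕ) (ξ : Fin n → H) (hξ : ∑ j, ‖ξ j‖ ^ 2 ≤ 1) :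
    11 / 100 * m.real {x | l ≤ Real.sqrt (∑ j, T (ξ j) x ^ 2)} ≤ δ + 1 / R ^ 2 := by
  set A := {x | l ≤ Real.sqrt (∑ j, T (ξ j) x ^ 2)} with hA
  have hAm : MeasurableSet A := measurableSet_le measurable_const (by fun_prop)
  let ζ : (Fin n → Bool) → H := fun e => ∑ j, sg11 (e j) • ξ j
  let B : (Fin n → Bool) → Set X := fun e => {x | l / 2 ≤ |T (ζ e) x|}
  have hBm : ∀ e, MeasurableSet (B e) := fun e =>
    measurableSet_le measurable_const (hT_meas _).abs
  have hB : ∀ e, m.real (B e) ≤ δ + ‖ζ e‖ ^ 2 / R ^ 2 := by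
    intro e
    rcases le_total ‖ζ e‖ R with h | h
    · have := hM _ h
      have h2 : 0 ≤ ‖ζ e‖ ^ 2 / R ^ 2 := by positivity
      change m.real {x | l / 2 ≤ |T (ζ e) x|} ≤ _
      linarith
    · have h1 : m.real (B e) ≤ 1 := measureReal_le_one
      have h2 : 1 ≤ ‖ζ e‖ ^ 2 / R ^ 2 := by
        rw [le_div_iff₀ (by positivity), one_mul]
        exact pow_le_pow_left₀ hR.le h 2
      linarith
  have hint : ∫ x, A.indicator (fun _ => (11 / 100 : ℝ) * 2 ^ n) x ∂m
      ≤ ∫ x, ∑ e, (B e).indicator (fun _ => (1 : ℝ)) x ∂m := by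
    refine integral_mono_ae ((integrable_const _).indicator hAm)
      (integrable_finset_sum _ (fun e _ => (integrable_const _).indicator (hBm e))) ?_
    have hall : ∀ᵐ x ∂m, ∀ e : Fin n → Bool, T (ζ e) x = ∑ j, sg11 (e j) * T (ξ j) x :=
      ae_all_iff.2 (fun e => lin11 m T hT_add hT_smul n ξ (fun j => sg11 (e j)))
    filter_upwards [hall] with x hx
    by_cases hxA : x ∈ A
    · rw [Set.indicator_of_mem hxA]
      refine (pz11 n (fun j => T (ξ j) x) l hl hxA).trans (le_of_eq ?_)
      refine Finset.sum_congr rfl (fun e _ => ?_)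
      simp only [Set.indicator_apply, B, Set.mem_setOf_eq, hx e]
    · rw [Set.indicator_of_notMem hxA]
      exact Finset.sum_nonneg (fun e _ => Set.indicator_nonneg (fun _ _ => zero_le_one) _)
  rw [integral_finset_sum _ (fun e _ => (integrable_const _).indicator (hBm e)),
    integral_indicator_const _ hAm] at hint
  simp only [fun e => integral_indicator_const (μ := m) (1 : ℝ) (hBm e), smul_eq_mul,
    mul_one] at hint
  have h1 := hint.trans (Finset.sum_le_sum (fun e _ => hB e))
  rw [Finset.sum_add_distrib, ← Finset.sum_div, second11 n ξ] at h1
  simp only [Finset.sum_const, Finset.card_univ, Fintype.card_fun, Fintype.card_bool,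
      Fintype.card_fin, nsmul_eq_mul] at h1
  push_cast at h1
  have h2 : 2 ^ n * (∑ j, ‖ξ j‖ ^ 2) / R ^ 2 ≤ 2 ^ n * (1 / R ^ 2) := by
    rw [mul_div_assoc]; gcongr
  have h3 : (0 : ℝ) < 2 ^ n := by positivity
  refine le_of_mul_le_mul_left ?_ h3
  linarith


/-- If `T : H → L⁰(X,m)` is a linear map, continuous in measure, from a
separable real Hilbert space, then there is `C : (0,∞) → [0,1]` with `C(λ) → 0` as `λ → ∞`
such that for all `ξ₁,…,ξₙ ∈ H` with `Σ ‖ξⱼ‖² ≤ 1` and all `λ > 0`,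
`m {x | (Σⱼ (Tξⱼ)(x)²)^{1/2} ≥ λ} ≤ C(λ)`. -/
theorem stmt11 {H X : Type*} [NormedAddCommGroup H] [InnerProductSpace ℝ H] [CompleteSpace H]
    [TopologicalSpace.SeparableSpace H] [MeasurableSpace X]
    (m : Measure X) [IsProbabilityMeasure m]
    (T : H → X → ℝ)
    (hT_meas : ∀ ξ, Measurable (T ξ))
    (hT_add : ∀ ξ η, T (ξ + η) =ᵐ[m] fun x => T ξ x + T η x)
    (hT_smul : ∀ (r : ℝ) (ξ : H), T (r • ξ) =ᵐ[m] fun x => r * T ξ x)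
    (hT_cont : ∀ (ξs : ℕ → H) (ξ : H), Tendsto ξs atTop (nhds ξ) →
      TendstoInMeasure m (fun n => T (ξs n)) atTop (T ξ)) :
    ∃ C : ℝ → ℝ, (∀ l, 0 < l → C l ∈ Set.Icc (0 : ℝ) 1) ∧ Tendsto C atTop (nhds 0) ∧
      ∀ (n : ℕ) (ξ : Fin n → H), (∑ j, ‖ξ j‖ ^ 2) ≤ 1 →
        ∀ l : ℝ, 0 < l →
          m {x | l ≤ Real.sqrt (∑ j, T (ξ j) x ^ 2)} ≤ ENNReal.ofReal (C l) := by
  let P : ℝ → Set ℝ := fun l => {r | ∃ (n : ℕ) (ξ : Fin n → H), (∑ j, ‖ξ j‖ ^ 2) ≤ 1 ∧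
    r = m.real {x | l ≤ Real.sqrt (∑ j, T (ξ j) x ^ 2)}}
  have hP1 : ∀ l, ∀ r ∈ P l, r ≤ 1 := by
    rintro l r ⟨n, ξ, -, rfl⟩; exact measureReal_le_one
  have hP0 : ∀ l, ∀ r ∈ P l, 0 ≤ r := by
    rintro l r ⟨n, ξ, -, rfl⟩; exact measureReal_nonneg
  have hbdd : ∀ l, BddAbove (P l) := fun l => ⟨1, hP1 l⟩
  refine ⟨fun l => sSup (P l), fun l _ => ⟨Real.sSup_nonneg (hP0 l),
    Real.sSup_le (hP1 l) zero_le_one⟩, ?_, ?_⟩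
  · rw [Metric.tendsto_atTop]
    intro ε hε
    obtain ⟨R, hR, hRε⟩ : ∃ R : ℝ, 0 < R ∧ 1 / R ^ 2 ≤ ε / 100 := by
      refine ⟨Real.sqrt (100 / ε), by positivity, ?_⟩
      rw [Real.sq_sqrt (by positivity)]
      simp
    obtain ⟨M, hM⟩ := unif11 m T hT_smul hT_cont R (ε / 100) (by positivity)
    refine ⟨max 1 (2 * M), fun l hl => ?_⟩
    have hl1 : 1 ≤ l := (le_max_left _ _).trans hl
    have hl2 : 2 * M ≤ l := (le_max_right _ _).trans hl
    rw [Real.dist_eq, sub_zero, abs_of_nonneg (Real.sSup_nonneg (hP0 l))]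
    refine lt_of_le_of_lt (Real.sSup_le (a := ε / 2) ?_ (by positivity)) (by linarith)
    rintro r ⟨n, ξ, hξ, rfl⟩
    have := main11 m T hT_meas hT_add hT_smul l R (ε / 100) (by linarith) hR (by positivity)
      (fun η hη => (measureReal_mono (fun x (hx : l / 2 ≤ |T η x|) =>
        (show M ≤ |T η x| by linarith))).trans (hM η hη)) n ξ hξ
    linarith
  · intro n ξ hξ l hl
    rw [← ofReal_measureReal]
    exact ENNReal.ofReal_le_ofReal (le_csSup (hbdd l) ⟨n, ξ, hξ, rfl⟩)
end

section
/- (Dixmier's unitarizability criterion.) Let Γ be a group, H a complex Hilbert space, and π : Γ → GL(H) a group homomorphism into the bounded invertible operators on H. Then the following are equivalent: (i) π is unitarizable, i.e. there exists a bounded invertible operator V on H such that V⁻¹ π(s) V is unitary for every s ∈ Γ; (ii) there exists a bounded, self-adjoint, invertible operator B on H with ⟨Bξ,ξ⟩ > 0 for all ξ ≠ 0, such that π(s)* B π(s) = B for every s ∈ Γ. -/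
open scoped InnerProductSpace ComplexOrder

/-- Dixmier's unitarizability criterion.  A homomorphism
`π : Γ → GL(H)` into the invertible bounded operators on a complex Hilbert space is
unitarizable iff there is a bounded self-adjoint invertible operator `B` with
`⟨Bξ,ξ⟩ > 0` for `ξ ≠ 0` and `π(s)* B π(s) = B` for every `s`. -/
theorem stmt13 {Γ H : Type*} [Group Γ]
    [NormedAddCommGroup H] [InnerProductSpace ℂ H] [CompleteSpace H]
    (π : Γ →* (H →L[ℂ] H)ˣ) :
    (∃ V : (H →L[ℂ] H)ˣ, ∀ (s : Γ) (ξ η : H),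
        ⟪((V⁻¹ * π s * V : (H →L[ℂ] H)ˣ) : H →L[ℂ] H) ξ,
          ((V⁻¹ * π s * V : (H →L[ℂ] H)ˣ) : H →L[ℂ] H) η⟫_ℂ = ⟪ξ, η⟫_ℂ) ↔
      (∃ B : H →L[ℂ] H, IsSelfAdjoint B ∧ IsUnit B ∧
        (∀ ξ : H, ξ ≠ 0 → 0 < ⟪B ξ, ξ⟫_ℂ) ∧
        ∀ s : Γ, ContinuousLinearMap.adjoint (π s : H →L[ℂ] H) ∘L B ∘L
          (π s : H →L[ℂ] H) = B) := by
  constructor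
  · rintro ⟨V, hV⟩
    set W : H →L[ℂ] H := ((V⁻¹ : (H →L[ℂ] H)ˣ) : H →L[ℂ] H) with hW
    have hVW : ∀ x, (V : H →L[ℂ] H) (W x) = x := fun x => by
      have h : (V : H →L[ℂ] H) * W = 1 := V.mul_inv
      exact congrArg (fun T : H →L[ℂ] H => T x) h
    have hinner : ∀ x y, ⟪(ContinuousLinearMap.adjoint W * W) x, y⟫_ℂ = ⟪W x, W y⟫_ℂ := by
      intro x y
      rw [ContinuousLinearMap.mul_apply, ContinuousLinearMap.adjoint_inner_left]
    refine ⟨ContinuousLinearMap.adjoint W * W, ?_, ?_, ?_, ?_⟩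
    · exact IsSelfAdjoint.star_mul_self W
    · have hu : IsUnit W := (V⁻¹).isUnit
      exact IsUnit.mul hu.star hu
    · intro ξ hξ
      rw [hinner]
      have hne : W ξ ≠ 0 := fun h => hξ (by rw [← hVW ξ, h, map_zero])
      rw [inner_self_eq_norm_sq_to_K]
      have hn : (0 : ℝ) < ‖W ξ‖ ^ 2 := pow_pos (norm_pos_iff.2 hne) 2
      have hn2 := Complex.zero_lt_real.2 hn
      rw [Complex.ofReal_pow] at hn2
      exact hn2
    · intro s
      ext x
      refine ext_inner_right ℂ fun y => ?_
      have h := hV s (W x) (W y)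
      simp only [Units.val_mul, ContinuousLinearMap.mul_apply, hVW, ← hW] at h
      rw [ContinuousLinearMap.comp_apply, ContinuousLinearMap.adjoint_inner_left,
        ContinuousLinearMap.comp_apply, hinner, hinner, h]
  · rintro ⟨B, hsa, hu, hpos, hinv⟩
    have hB : 0 ≤ B := by
      rw [ContinuousLinearMap.nonneg_iff_isPositive, ContinuousLinearMap.isPositive_iff']
      refine ⟨hsa, fun x => ?_⟩
      by_cases hx : x = 0
      · simp [hx]
      · exact (hpos x hx).le
    have hSS : CFC.sqrt B * CFC.sqrt B = B := CFC.sqrt_mul_sqrt_self B hB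
    have hS : IsSelfAdjoint (CFC.sqrt B) := IsSelfAdjoint.of_nonneg (CFC.sqrt_nonneg B)
    have hSu : IsUnit (CFC.sqrt B) := by
      rw [← hSS] at hu
      exact isUnit_mul_self_iff.1 hu
    obtain ⟨S, hSe⟩ := hSu
    rw [← hSe] at hSS hS
    have hinner : ∀ x y, ⟪(S : H →L[ℂ] H) x, (S : H →L[ℂ] H) y⟫_ℂ = ⟪B x, y⟫_ℂ := by
      intro x y
      rw [← hSS, ContinuousLinearMap.mul_apply, ← ContinuousLinearMap.adjoint_inner_left,
        ContinuousLinearMap.isSelfAdjoint_iff'.1 hS]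
    have hc : ∀ x, (S : H →L[ℂ] H) (((S⁻¹ : (H →L[ℂ] H)ˣ) : H →L[ℂ] H) x) = x := fun x =>
      congrArg (fun T : H →L[ℂ] H => T x) S.mul_inv
    refine ⟨S⁻¹, fun s ξ η => ?_⟩
    simp only [inv_inv, Units.val_mul, ContinuousLinearMap.mul_apply]
    rw [hinner, ← ContinuousLinearMap.adjoint_inner_left]
    have h := fun x => congrArg (fun T : H →L[ℂ] H => T x) (hinv s)
    simp only [ContinuousLinearMap.comp_apply] at h
    rw [h, ← hinner, hc, hc]
end
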